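/- Let n ≥ 3 and let φ be a Hörmander-type phase function on M × Σ ⊆ ℝⁿ × ℝ^{n−1} satisfying Bourgain's condition, with fixed compact parameter sets M₀, Σ₀, 𝒱₀ as in the tube setup. Suppose the discretized classical sticky Kakeya conjecture holds in ℝⁿ: for every ε > 0 there exist η > 0 and δ₀ > 0 such that SK′(φ_{n,rest}, ε, η, δ) holds for all δ ∈ (0, δ₀). Then the same conclusion holds for φ: for every ε > 0 there exist η > 0 and δ₀ > 0 such that SK′(φ, ε, η, δ) holds for all δ ∈ (0, δ₀). -/

import Mathlib

open Metric Set Topology MeasureTheory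

noncomputable section

/-- ξ-gradient ∇_ξφ(x,ξ). -/
def gradXi (n : ℕ) (φ : (Fin n → ℝ) → (Fin (n-1) → ℝ) → ℝ)
    (x : Fin n → ℝ) (ξ : Fin (n-1) → ℝ) : Fin (n-1) → ℝ :=
  fun j => fderiv ℝ (φ x) ξ (Pi.single j (1:ℝ))

/-- ξ-Hessian ∇_ξ²φ(x,ξ). -/
def hessXi (n : ℕ) (φ : (Fin n → ℝ) → (Fin (n-1) → ℝ) → ℝ)
    (x : Fin n → ℝ) (ξ : Fin (n-1) → ℝ) : Matrix (Fin (n-1)) (Fin (n-1)) ℝ :=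
  Matrix.of fun i j => fderiv ℝ (fun η => gradXi n φ x η i) ξ (Pi.single j (1:ℝ))

/-- Mixed Hessian ∇_x∇_ξφ(x,ξ) : entry (i,j) is ∂_{x_i}∂_{ξ_j}φ. -/
def mixedHess (n : ℕ) (φ : (Fin n → ℝ) → (Fin (n-1) → ℝ) → ℝ)
    (x : Fin n → ℝ) (ξ : Fin (n-1) → ℝ) : Matrix (Fin n) (Fin (n-1)) ℝ :=
  Matrix.of fun i j => fderiv ℝ (fun y => gradXi n φ y ξ j) x (Pi.single i (1:ℝ))

/-- Gauss map: G(x,ξ)ᵢ = det(∂_{ξ_1}∇_xφ, …, ∂_{ξ_{n-1}}∇_xφ, eᵢ), so that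
⟨G(x,ξ), w⟩ = det(∂_{ξ_1}∇_xφ, …, ∂_{ξ_{n-1}}∇_xφ, w) for all w. -/
def gaussMap (n : ℕ) (φ : (Fin n → ℝ) → (Fin (n-1) → ℝ) → ℝ)
    (x : Fin n → ℝ) (ξ : Fin (n-1) → ℝ) : Fin n → ℝ :=
  fun i => Matrix.det (Matrix.of fun a b : Fin n =>
    if h : (b : ℕ) < n - 1 then mixedHess n φ x ξ a ⟨(b : ℕ), h⟩
    else (Pi.single i (1:ℝ) : Fin n → ℝ) a)

/-- Directional derivative (G(x,ξ)·∇_x) f at x. -/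
def GD (n : ℕ) (φ : (Fin n → ℝ) → (Fin (n-1) → ℝ) → ℝ)
    (f : (Fin n → ℝ) → ℝ) (ξ : Fin (n-1) → ℝ) (x : Fin n → ℝ) : ℝ :=
  fderiv ℝ f x (gaussMap n φ x ξ)

/-- The matrix (G(x,ξ)·∇_x)∇_ξ²φ(x,ξ). -/
def GDhess (n : ℕ) (φ : (Fin n → ℝ) → (Fin (n-1) → ℝ) → ℝ)
    (x : Fin n → ℝ) (ξ : Fin (n-1) → ℝ) : Matrix (Fin (n-1)) (Fin (n-1)) ℝ :=
  Matrix.of fun i j => GD n φ (fun y => hessXi n φ y ξ i j) ξ x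

/-- The matrix (G(x,ξ)·∇_x)²∇_ξ²φ(x,ξ). -/
def GD2hess (n : ℕ) (φ : (Fin n → ℝ) → (Fin (n-1) → ℝ) → ℝ)
    (x : Fin n → ℝ) (ξ : Fin (n-1) → ℝ) : Matrix (Fin (n-1)) (Fin (n-1)) ℝ :=
  Matrix.of fun i j => GD n φ (fun y => GD n φ (fun z => hessXi n φ z ξ i j) ξ y) ξ x

/-- Bourgain's condition on M × Σ. -/
def BourgainCond (n : ℕ) (φ : (Fin n → ℝ) → (Fin (n-1) → ℝ) → ℝ)
    (M : Set (Fin n → ℝ)) (Ω : Set (Fin (n-1) → ℝ)) : Prop :=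
  ∃ lam : (Fin n → ℝ) → (Fin (n-1) → ℝ) → ℝ,
    ∀ x ∈ M, ∀ ξ ∈ Ω, GD2hess n φ x ξ = lam x ξ • GDhess n φ x ξ

/-- Hörmander-type phase function: smooth, (H1) and (H2) on M × Σ. -/
def IsHormander (n : ℕ) (φ : (Fin n → ℝ) → (Fin (n-1) → ℝ) → ℝ)
    (M : Set (Fin n → ℝ)) (Ω : Set (Fin (n-1) → ℝ)) : Prop :=
  ContDiffOn ℝ (⊤ : ℕ∞) (fun q : (Fin n → ℝ) × (Fin (n-1) → ℝ) => φ q.1 q.2) (M ×ˢ Ω) ∧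
  (∀ x ∈ M, ∀ ξ ∈ Ω, (mixedHess n φ x ξ).rank = n - 1) ∧
  (∀ x ∈ M, ∀ ξ ∈ Ω, (GDhess n φ x ξ).det ≠ 0)

/-- The point (x̄, t) ∈ ℝⁿ. -/
def toPt (n : ℕ) (xb : Fin (n-1) → ℝ) (t : ℝ) : Fin n → ℝ :=
  fun i => if h : (i : ℕ) < n - 1 then xb ⟨(i : ℕ), h⟩ else t

/-- line_{ξ,v} = {(v,0) − s(ξ,1) : s ∈ ℝ} ⊆ ℝⁿ. -/
def lineSet (n : ℕ) (ξ v : Fin (n-1) → ℝ) : Set (Fin n → ℝ) :=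
  {p | ∃ s : ℝ, p = toPt n v 0 - s • toPt n ξ 1}

end

noncomputable section

/-- The φ-curve ℓ_{ξ,v} = {x ∈ M : ∇_ξφ(x,ξ) = v}. -/
def curveSet (n : ℕ) (φ : (Fin n → ℝ) → (Fin (n-1) → ℝ) → ℝ)
    (M : Set (Fin n → ℝ)) (ξ v : Fin (n-1) → ℝ) : Set (Fin n → ℝ) :=
  {x ∈ M | gradXi n φ x ξ = v}

/-- The (δ,φ)-tube with parameter p = (ξ,v): the δ-neighborhood of ℓ_{ξ,v} ∩ M₀. -/
def tube (n : ℕ) (φ : (Fin n → ℝ) → (Fin (n-1) → ℝ) → ℝ)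
    (M M₀ : Set (Fin n → ℝ)) (δ : ℝ)
    (p : (Fin (n-1) → ℝ) × (Fin (n-1) → ℝ)) : Set (Fin n → ℝ) :=
  {y | ∃ x ∈ curveSet n φ M p.1 p.2 ∩ M₀, dist y x ≤ δ}

/-- The assertion SK′(φ, ε, η, δ): for every finite collection of essentially distinct
(δ,φ)-tubes which for each δ ≤ ρ ≤ 1 can be covered by (ρ,φ)-tubes of which at most
δ^{-η} are pairwise essentially parallel, and every shading Y with
Σ_T |Y(T)| ≥ δ^η, one has |⋃_T Y(T)| ≥ δ^ε. -/
def SKp (n : ℕ) (φ : (Fin n → ℝ) → (Fin (n-1) → ℝ) → ℝ)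
    (M M₀ : Set (Fin n → ℝ)) (S₀ : Set (Fin (n-1) → ℝ)) (ε η δ : ℝ) : Prop :=
  let V₀ : Set (Fin (n-1) → ℝ) :=
    (fun q : (Fin n → ℝ) × (Fin (n-1) → ℝ) => gradXi n φ q.1 q.2) '' (M₀ ×ˢ S₀)
  ∀ P : Finset ((Fin (n-1) → ℝ) × (Fin (n-1) → ℝ)),
    (∀ p ∈ P, p ∈ S₀ ×ˢ V₀) →
    (∀ p ∈ P, ∀ q ∈ P, p ≠ q → δ ≤ dist p q) →
    (∀ ρ ∈ Set.Icc δ 1, ∃ Q : Finset ((Fin (n-1) → ℝ) × (Fin (n-1) → ℝ)),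
      (∀ q ∈ Q, q ∈ S₀ ×ˢ V₀) ∧
      (∀ p ∈ P, Metric.ball p δ ⊆ ⋃ q ∈ Q, Metric.ball q ρ) ∧
      (∀ S ⊆ Q, (∀ q ∈ S, ∀ q' ∈ S, dist q.1 q'.1 ≤ ρ) → (S.card : ℝ) ≤ δ ^ (-η))) →
    ∀ Y : ((Fin (n-1) → ℝ) × (Fin (n-1) → ℝ)) → Set (Fin n → ℝ),
      (∀ p ∈ P, MeasurableSet (Y p) ∧ Y p ⊆ tube n φ M M₀ δ p) →
      ENNReal.ofReal (δ ^ η) ≤ ∑ p ∈ P, volume (Y p) →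
      ENNReal.ofReal (δ ^ ε) ≤ volume (⋃ p ∈ P, Y p)

end

noncomputable section

/-- The restriction phase φ_{n,rest}((x,t),ξ) = x·ξ + ½ t |ξ|², with n = m+1 variables
x = (x 0, …, x (m-1)) and t = x m. -/
def φrest (m : ℕ) (x : Fin (m+1) → ℝ) (ξ : Fin m → ℝ) : ℝ :=
  (∑ j : Fin m, x (Fin.castSucc j) * ξ j) + (1/2) * x (Fin.last m) * (∑ j : Fin m, (ξ j)^2)

end

section

/-- The points of `P` are pairwise at distance at least `δ`. -/
def SeparatedBy {α : Type*} [PseudoMetricSpace α] (δ : ℝ) (P : Finset α) : Prop :=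
  ∀ p ∈ P, ∀ q ∈ P, p ≠ q → δ ≤ dist p q

/-- At every scale `σ ∈ [δ, 1]`, at most `N` of the `σ`-separated points of `P` have first
components within `σ` of each other. -/
def StickyCount {d : ℕ} (P : Finset ((Fin d → ℝ) × (Fin d → ℝ))) (δ N : ℝ) : Prop :=
  ∀ σ ∈ Icc δ 1, ∀ S ⊆ P, SeparatedBy σ S → (∀ q ∈ S, ∀ q' ∈ S, dist q.1 q'.1 ≤ σ) → (S.card : ℝ) ≤ N

lemma SeparatedBy.mono {α : Type*} [PseudoMetricSpace α] {δ : ℝ} {P Q : Finset α} (h : SeparatedBy δ P)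
    (hQ : Q ⊆ P) : SeparatedBy δ Q :=
  fun p hp q hq => h p (hQ hp) q (hQ hq)

lemma SeparatedBy.of_le {α : Type*} [PseudoMetricSpace α] {δ δ' : ℝ} {P : Finset α} (h : SeparatedBy δ P)
    (hQ : δ' ≤ δ) : SeparatedBy δ' P :=
  fun p hp q hq hne => hQ.trans (h p hp q hq hne)

lemma StickyCount.mono {d : ℕ} {P Q : Finset ((Fin d → ℝ) × (Fin d → ℝ))} {δ δ' N N' : ℝ}
    (h : StickyCount P δ N) (hQ : Q ⊆ P) (hδ : δ ≤ δ') (hN : N ≤ N') : StickyCount Q δ' N' :=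
  fun σ hσ S hS h1 h2 => (h σ ⟨hδ.trans hσ.1, hσ.2⟩ S (hS.trans hQ) h1 h2).trans hN

/-- A finite set whose image under `f` has diameter at most `R * σ` splits into `(2R+1)^k` cells on
each of which `f` oscillates by at most `σ`. -/
lemma card_le_of_cells {α : Type*} {k : ℕ} (S : Finset α) (f : α → Fin k → ℝ)
    (R : ℕ) {σ N : ℝ} (hσ : 0 < σ) (hR : ∀ a ∈ S, ∀ b ∈ S, dist (f a) (f b) ≤ R * σ)
    (hN : ∀ T ⊆ S, (∀ a ∈ T, ∀ b ∈ T, dist (f a) (f b) ≤ σ) → (T.card : ℝ) ≤ N) :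
    (S.card : ℝ) ≤ (2 * R + 1) ^ k * N := by
  classical
  have hN0 : 0 ≤ N := by simpa using hN ∅ (by simp) (by simp)
  rcases S.eq_empty_or_nonempty with rfl | ⟨a₀, ha₀⟩
  · simp only [Finset.card_empty, Nat.cast_zero]; positivity
  let c : α → Fin k → ℤ := fun a i => ⌊(f a i - f a₀ i) / σ⌋
  let G : Finset (Fin k → ℤ) := Fintype.piFinset fun _ => Finset.Icc (-(R : ℤ)) R
  have hmem : ∀ a ∈ S, c a ∈ G := by
    intro a ha
    simp only [G, c, Fintype.mem_piFinset, Finset.mem_Icc]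
    intro i
    have h1 : |f a i - f a₀ i| ≤ R * σ := by
      rw [← Real.dist_eq]; exact (dist_le_pi_dist _ _ i).trans (hR a ha a₀ ha₀)
    rw [abs_le] at h1
    constructor
    · rw [Int.le_floor, le_div_iff₀ hσ]; push_cast; linarith
    · have : (⌊(f a i - f a₀ i) / σ⌋ : ℝ) ≤ R :=
        (Int.floor_le _).trans ((div_le_iff₀ hσ).2 h1.2)
      exact_mod_cast this
  have hcard : (S.card : ℝ) = ∑ g ∈ G, ((S.filter fun a => c a = g).card : ℝ) := by
    exact_mod_cast Finset.card_eq_sum_card_fiberwise hmem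
  have hG : (G.card : ℝ) = (2 * R + 1) ^ k := by
    simp only [G, Fintype.card_piFinset, Int.card_Icc, Finset.prod_const, Finset.card_univ,
      Fintype.card_fin]
    have : ((R : ℤ) + 1 - -(R : ℤ)).toNat = 2 * R + 1 := by omega
    rw [this]; push_cast; ring
  rw [hcard, ← hG, ← nsmul_eq_mul]
  refine Finset.sum_le_card_nsmul _ _ _ fun g _ => hN _ (Finset.filter_subset _ _) ?_
  intro a ha b hb
  rw [Finset.mem_filter] at ha hb
  refine (dist_pi_le_iff hσ.le).2 fun i => ?_
  have hi : ⌊(f a i - f a₀ i) / σ⌋ = ⌊(f b i - f a₀ i) / σ⌋ :=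
    congrFun (ha.2.trans hb.2.symm) i
  have h2 := Int.abs_sub_lt_one_of_floor_eq_floor hi
  rw [← sub_div, abs_div, abs_of_pos hσ, div_lt_one hσ] at h2
  rw [Real.dist_eq]
  have : f a i - f a₀ i - (f b i - f a₀ i) = f a i - f b i := by ring
  rw [this] at h2
  exact h2.le

/-- A `σ`-separated set of diameter at most `R * (σ / 2)` has boundedly many points. -/
lemma card_le_of_sep {d : ℕ} (S : Finset ((Fin d → ℝ) × (Fin d → ℝ))) (R : ℕ) {σ : ℝ}
    (hσ : 0 < σ) (hS : SeparatedBy σ S) (hR : ∀ a ∈ S, ∀ b ∈ S, dist a b ≤ R * (σ / 2)) :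
    (S.card : ℝ) ≤ (2 * R + 1) ^ d * (2 * R + 1) ^ d := by
  refine card_le_of_cells S Prod.fst R (half_pos hσ)
    (fun a ha b hb => (le_max_left _ _).trans (hR a ha b hb)) fun T hT h1 => ?_
  rw [← mul_one ((2 * (R : ℝ) + 1) ^ d)]
  refine card_le_of_cells T Prod.snd R (half_pos hσ)
    (fun a ha b hb => (le_max_right _ _).trans (hR a (hT ha) b (hT hb))) fun T' hT' h2 => ?_
  have : T'.card ≤ 1 := by
    refine Finset.card_le_one.2 fun a ha b hb => ?_
    by_contra hne
    have h3 := hS a (hT (hT' ha)) b (hT (hT' hb)) hne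
    have h4 : dist a b ≤ σ / 2 := max_le (h1 a (hT' ha) b (hT' hb)) (h2 a ha b hb)
    linarith
  exact_mod_cast this

/-- A maximal separated subset. -/
lemma exists_maximal_sep {α : Type*} [PseudoMetricSpace α] (P : Finset α) {r : ℝ}
    (hr : 0 < r) : ∃ Q ⊆ P, SeparatedBy r Q ∧ ∀ p ∈ P, ∃ q ∈ Q, dist p q < r := by
  classical
  induction P using Finset.induction_on with
  | empty => exact ⟨∅, by simp, by simp [SeparatedBy], by simp⟩
  | insert a P ha ih =>
    obtain ⟨Q, hQ, hs, hc⟩ := ih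
    by_cases h : ∃ q ∈ Q, dist a q < r
    · refine ⟨Q, hQ.trans (Finset.subset_insert _ _), hs, ?_⟩
      intro p hp
      rcases Finset.mem_insert.1 hp with rfl | hp
      · exact h
      · exact hc p hp
    · push Not at h
      refine ⟨insert a Q, Finset.insert_subset_insert _ hQ, ?_, ?_⟩
      · intro p hp q hq hne
        rcases Finset.mem_insert.1 hp with rfl | hp' <;>
          rcases Finset.mem_insert.1 hq with rfl | hq'
        · exact absurd rfl hne
        · exact h q hq'
        · rw [dist_comm]; exact h p hp'
        · exact hs p hp' q hq' hne
      · intro p hp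
        rcases Finset.mem_insert.1 hp with rfl | hp
        · exact ⟨p, Finset.mem_insert_self _ _, by simpa using hr⟩
        · obtain ⟨q, hq, h⟩ := hc p hp
          exact ⟨q, Finset.mem_insert_of_mem hq, h⟩

/-- Greedy selection of a separated subset carrying a fixed proportion of the total weight. -/
lemma exists_sep_weight {α : Type*} [PseudoMetricSpace α] (P : Finset α) (w : α → ENNReal)
    {r : ℝ} (D : ℕ) (hr : 0 < r) (hD : ∀ S ⊆ P, ∀ p ∈ P, (∀ q ∈ S, dist p q < r) → S.card ≤ D) :
    ∃ Q ⊆ P, SeparatedBy r Q ∧ ∑ p ∈ P, w p ≤ D * ∑ q ∈ Q, w q := by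
  classical
  induction P using Finset.strongInduction with
  | H P ih =>
    rcases P.eq_empty_or_nonempty with rfl | hne
    · exact ⟨∅, by simp, by simp [SeparatedBy], by simp⟩
    obtain ⟨a, ha, hmax⟩ := P.exists_max_image w hne
    let P₁ := P.filter fun q => ¬ dist a q < r
    have hsub : P₁ ⊆ P := Finset.filter_subset _ _
    have haP₁ : a ∉ P₁ := by simp [P₁, hr]
    have hss : P₁ ⊂ P := (Finset.ssubset_iff_of_subset hsub).2 ⟨a, ha, haP₁⟩
    obtain ⟨Q, hQ, hs, hw⟩ := ih P₁ hss fun S hS p hp => hD S (hS.trans hsub) p (hsub hp)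
    have haQ : a ∉ Q := fun h => haP₁ (hQ h)
    have hfar : ∀ q ∈ Q, r ≤ dist a q := fun q hq => not_lt.1 (Finset.mem_filter.1 (hQ hq)).2
    refine ⟨insert a Q, Finset.insert_subset ha (hQ.trans hsub), ?_, ?_⟩
    · intro p hp q hq hne
      rcases Finset.mem_insert.1 hp with rfl | hp' <;>
          rcases Finset.mem_insert.1 hq with rfl | hq'
      · exact absurd rfl hne
      · exact hfar q hq'
      · rw [dist_comm]; exact hfar p hp'
      · exact hs p hp' q hq' hne
    · rw [Finset.sum_insert haQ, mul_add, ← Finset.sum_filter_add_sum_filter_not P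
        (fun q => dist a q < r)]
      refine add_le_add ?_ hw
      calc ∑ q ∈ P.filter (fun q => dist a q < r), w q
          ≤ (P.filter (fun q => dist a q < r)).card • w a :=
            Finset.sum_le_card_nsmul _ _ _ fun q hq => hmax q (Finset.mem_filter.1 hq).1
        _ = ((P.filter (fun q => dist a q < r)).card : ENNReal) * w a := nsmul_eq_mul _ _
        _ ≤ D * w a := by
            gcongr
            exact hD _ (Finset.filter_subset _ _) a ha fun q hq => (Finset.mem_filter.1 hq).2

/-- Counting with weaker closeness of first components. -/
lemma StickyCount.card_le {d : ℕ} {P S : Finset ((Fin d → ℝ) × (Fin d → ℝ))} {δ N σ : ℝ}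
    (h : StickyCount P δ N) (hδ : 0 < δ) (hσ : σ ∈ Icc δ 1) (hS : S ⊆ P) (hsep : SeparatedBy σ S) (R : ℕ)
    (hR : ∀ q ∈ S, ∀ q' ∈ S, dist q.1 q'.1 ≤ R * σ) :
    (S.card : ℝ) ≤ (2 * R + 1) ^ d * N :=
  card_le_of_cells S Prod.fst R (hδ.trans_le hσ.1) hR fun T hT h2 =>
    h σ hσ T (hT.trans hS) (hsep.mono hT) h2

/-- The covering hypothesis of sticky Kakeya, at multiplicity `N`, implies a counting bound. -/
lemma stickyCount_of_cover {d : ℕ} {P : Finset ((Fin d → ℝ) × (Fin d → ℝ))} {δ N : ℝ}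
    (hδ : 0 < δ)
    (h : ∀ ρ ∈ Set.Icc δ 1, ∃ Q : Finset ((Fin d → ℝ) × (Fin d → ℝ)),
      (∀ p ∈ P, Metric.ball p δ ⊆ ⋃ q ∈ Q, Metric.ball q ρ) ∧
      (∀ S ⊆ Q, (∀ q ∈ S, ∀ q' ∈ S, dist q.1 q'.1 ≤ ρ) → (S.card : ℝ) ≤ N)) :
    StickyCount P δ (9 ^ d * 9 ^ d * (7 ^ d * N)) := by
  classical
  intro σ hσ S hS hsep hpar
  obtain ⟨Q, hcov, hQ⟩ := h σ hσ
  have hσ0 : 0 < σ := hδ.trans_le hσ.1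
  have : ∀ p, ∃ q, p ∈ S → q ∈ Q ∧ dist p q < σ := by
    intro p
    by_cases hp : p ∈ S
    · have h1 := hcov p (hS hp) (mem_ball_self hδ)
      simp only [mem_iUnion, mem_ball, exists_prop] at h1
      obtain ⟨q, hq, h2⟩ := h1
      exact ⟨q, fun _ => ⟨hq, h2⟩⟩
    · exact ⟨p, fun h => absurd h hp⟩
  choose f hf using this
  have hT : ((S.image f).card : ℝ) ≤ 7 ^ d * N := by
    have := card_le_of_cells (S.image f) Prod.fst 3 hσ0 ?_ (N := N) ?_
    · convert this using 3; norm_num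
    · intro a ha b hb
      obtain ⟨p, hp, rfl⟩ := Finset.mem_image.1 ha
      obtain ⟨q, hq, rfl⟩ := Finset.mem_image.1 hb
      have h1 : dist p.1 (f p).1 ≤ dist p (f p) := le_max_left _ _
      have h2 : dist q.1 (f q).1 ≤ dist q (f q) := le_max_left _ _
      have h3 := hpar p hp q hq
      have h4 := dist_triangle4 (f p).1 p.1 q.1 (f q).1
      rw [dist_comm (f p).1 p.1] at h4
      have := (hf p hp).2
      have := (hf q hq).2
      push_cast
      linarith
    · intro T hT h1
      refine hQ T (hT.trans ?_) h1
      intro a ha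
      obtain ⟨p, hp, rfl⟩ := Finset.mem_image.1 ha
      exact (hf p hp).1
  have hfib : ∀ q ∈ S.image f, ((S.filter fun p => f p = q).card : ℝ) ≤ 9 ^ d * 9 ^ d := by
    intro q _
    have := card_le_of_sep (S.filter fun p => f p = q) 4 hσ0 (hsep.mono (Finset.filter_subset _ _))
      ?_
    · convert this using 2 <;> norm_num
    · intro a ha b hb
      rw [Finset.mem_filter] at ha hb
      have h1 := (hf a ha.1).2
      have h2 := (hf b hb.1).2
      rw [ha.2] at h1
      rw [hb.2, dist_comm] at h2
      have := dist_triangle a q b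
      push_cast
      linarith
  have hcard : (S.card : ℝ) = ∑ q ∈ S.image f, ((S.filter fun p => f p = q).card : ℝ) := by
    exact_mod_cast Finset.card_eq_sum_card_fiberwise fun p hp => Finset.mem_image_of_mem f hp
  rw [hcard]
  calc _ ≤ ((S.image f).card : ℝ) * (9 ^ d * 9 ^ d) := by
        rw [← nsmul_eq_mul]; exact Finset.sum_le_card_nsmul _ _ _ hfib
    _ ≤ (7 ^ d * N) * (9 ^ d * 9 ^ d) := by gcongr
    _ = _ := by ring

/-- Conversely, a counting bound provides the coverings in the hypothesis of sticky Kakeya. -/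
lemma StickyCount.exists_cover {d : ℕ} {P : Finset ((Fin d → ℝ) × (Fin d → ℝ))} {δ N ρ : ℝ}
    (h : StickyCount P δ N) (hδ : 0 < δ) (hsep : SeparatedBy δ P) (hρ : ρ ∈ Icc δ 1) :
    ∃ Q ⊆ P, (∀ p ∈ P, Metric.ball p δ ⊆ ⋃ q ∈ Q, Metric.ball q ρ) ∧
      (∀ S ⊆ Q, (∀ q ∈ S, ∀ q' ∈ S, dist q.1 q'.1 ≤ ρ) → (S.card : ℝ) ≤ 5 ^ d * N) := by
  obtain ⟨hρ1, hρ2⟩ := hρ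
  have key : ∀ Q ⊆ P, ∀ σ ∈ Icc δ 1, ρ ≤ 2 * σ → SeparatedBy σ Q →
      (∀ S ⊆ Q, (∀ q ∈ S, ∀ q' ∈ S, dist q.1 q'.1 ≤ ρ) → (S.card : ℝ) ≤ 5 ^ d * N) := by
    intro Q hQ σ hσ h1 h2 S hS h3
    have := h.card_le hδ hσ (hS.trans hQ) (h2.mono hS) 2
      (fun q hq q' hq' => (h3 q hq q' hq').trans (by push_cast; exact h1))
    convert this using 3; norm_num
  rcases le_total (2 * δ) ρ with h2 | h2
  · obtain ⟨Q, hQ, hs, hc⟩ := exists_maximal_sep P (show 0 < ρ / 2 by linarith)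
    refine ⟨Q, hQ, ?_, key Q hQ (ρ / 2) ⟨by linarith, by linarith⟩ (by linarith) hs⟩
    intro p hp y hy
    obtain ⟨q, hq, hd⟩ := hc p hp
    rw [mem_ball] at hy
    simp only [mem_iUnion, mem_ball, exists_prop]
    refine ⟨q, hq, ?_⟩
    have := dist_triangle y p q
    linarith
  · refine ⟨P, subset_rfl, ?_, key P subset_rfl δ ⟨le_rfl, hρ1.trans hρ2⟩ h2 hsep⟩
    intro p hp y hy
    simp only [mem_iUnion, exists_prop]
    exact ⟨p, hp, ball_subset_ball hρ1 hy⟩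

end

section

/-- Uniform local control of a family of curves `{y | F y ξ = v}` in `ℝ^{d+1}` over the parameters
`ξ ∈ U`: the function `h` completes `F · ξ` to a bi-Lipschitz chart on `B`, and to first order in
`ξ` the curves are straight lines in this chart. -/
structure StraightenedPatch {d : ℕ} (B : Set (Fin (d + 1) → ℝ)) (U : Set (Fin d → ℝ))
    (F : (Fin (d + 1) → ℝ) → (Fin d → ℝ) → Fin d → ℝ)
    (h : (Fin (d + 1) → ℝ) → (Fin d → ℝ) → ℝ) (L : ℕ) : Prop where
  one_le : 1 ≤ L
  measurableSet : MeasurableSet B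
  dist_param_le : ∀ ξ ∈ U, ∀ ξ' ∈ U, dist ξ ξ' ≤ 1
  lip : ∀ y ∈ B, ∀ y' ∈ B, ∀ ξ ∈ U, ∀ ξ' ∈ U,
    dist (F y ξ) (F y' ξ') ≤ L * (dist y y' + dist ξ ξ')
  lip_h : ∀ y ∈ B, ∀ y' ∈ B, ∀ ξ ∈ U, dist (h y ξ) (h y' ξ) ≤ L * dist y y'
  osc_h : ∀ y ∈ B, ∀ y' ∈ B, ∀ ξ ∈ U, dist (h y ξ) (h y' ξ) ≤ 1
  antilip : ∀ y ∈ B, ∀ y' ∈ B, ∀ ξ ∈ U,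
    dist y y' ≤ L * max (dist (F y ξ) (F y' ξ)) (dist (h y ξ) (h y' ξ))
  approx : ∀ ξ₀ ∈ U, ∀ y₀ ∈ B, ∃ A R : (Fin d → ℝ) →ₗ[ℝ] (Fin d → ℝ),
    (∀ x, ‖A x‖ ≤ L * ‖x‖) ∧ (∀ x, ‖R x‖ ≤ L * ‖x‖) ∧ (∀ x, ‖x‖ ≤ L * ‖R x‖) ∧
    ∀ y ∈ B, ∀ ξ ∈ U,
      ‖F y ξ - F y ξ₀ - A (ξ - ξ₀) - (h y ξ₀ - h y₀ ξ₀) • R (ξ - ξ₀)‖ ≤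
        L * (‖ξ - ξ₀‖ + dist (F y ξ₀) (F y₀ ξ₀)) * ‖ξ - ξ₀‖

lemma volume_image_le_of_lip {n : ℕ} (f : (Fin n → ℝ) → (Fin n → ℝ)) (s : Set (Fin n → ℝ))
    (K : ℕ) (hf : ∀ x ∈ s, ∀ y ∈ s, dist (f x) (f y) ≤ K * dist x y) :
    volume (f '' s) ≤ K ^ n * volume s := by
  have h : LipschitzOnWith (K : NNReal) f s :=
    LipschitzOnWith.of_dist_le_mul fun x hx y hy => by simpa using hf x hx y hy
  have h1 := h.hausdorffMeasure_image_le (d := (n : ℝ)) (Nat.cast_nonneg n)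
  have h2 : (Measure.hausdorffMeasure (n : ℝ) : Measure (Fin n → ℝ)) = volume := by
    rw [← hausdorffMeasure_pi_real]; simp
  rw [h2] at h1
  simpa using h1

lemma volume_le_of_antilip {n : ℕ} (f : (Fin n → ℝ) → (Fin n → ℝ)) (s : Set (Fin n → ℝ))
    (K : ℕ) (hf : ∀ x ∈ s, ∀ y ∈ s, dist x y ≤ K * dist (f x) (f y)) :
    volume s ≤ K ^ n * volume (f '' s) := by
  rcases s.eq_empty_or_nonempty with rfl | hne
  · simp
  have hinj : InjOn f s := fun x hx y hy hxy => by
    have := hf x hx y hy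
    rw [hxy, dist_self, mul_zero] at this
    exact dist_le_zero.1 this
  have hinv := hinj.leftInvOn_invFunOn
  have h1 := volume_image_le_of_lip (Function.invFunOn f s) (f '' s) K ?_
  · rwa [hinv.image_image] at h1
  · rintro _ ⟨x, hx, rfl⟩ _ ⟨y, hy, rfl⟩
    rw [hinv hx, hinv hy]
    exact hf x hx y hy

/-- The chart `y ↦ (a (F(y,ξ) - v), h(y,ξ) - c)`. -/
def patchChart {d : ℕ} (F : (Fin (d + 1) → ℝ) → (Fin d → ℝ) → Fin d → ℝ)
    (h : (Fin (d + 1) → ℝ) → (Fin d → ℝ) → ℝ) (ξ : Fin d → ℝ) (a : ℝ) (v : Fin d → ℝ) (c : ℝ)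
    (y : Fin (d + 1) → ℝ) : Fin (d + 1) → ℝ :=
  Fin.snoc (α := fun _ => ℝ) (a • (F y ξ - v)) (h y ξ - c)

lemma dist_snoc {d : ℕ} (x y : Fin d → ℝ) (s t : ℝ) :
    dist (Fin.snoc (α := fun _ => ℝ) x s : Fin (d + 1) → ℝ) (Fin.snoc (α := fun _ => ℝ) y t) =
      max (dist x y) (dist s t) := by
  apply le_antisymm
  · refine (dist_pi_le_iff (le_max_of_le_left dist_nonneg)).2 fun i => ?_
    induction i using Fin.lastCases with
    | last => simp
    | cast i => simpa using Or.inl (dist_le_pi_dist x y i)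
  · refine max_le ((dist_pi_le_iff dist_nonneg).2 fun i => ?_) ?_
    · simpa using dist_le_pi_dist (Fin.snoc (α := fun _ => ℝ) x s : Fin (d + 1) → ℝ)
        (Fin.snoc (α := fun _ => ℝ) y t) i.castSucc
    · simpa using dist_le_pi_dist (Fin.snoc (α := fun _ => ℝ) x s : Fin (d + 1) → ℝ)
        (Fin.snoc (α := fun _ => ℝ) y t) (Fin.last d)

lemma volume_patchChart_image {d : ℕ} (F : (Fin (d + 1) → ℝ) → (Fin d → ℝ) → Fin d → ℝ)
    (h : (Fin (d + 1) → ℝ) → (Fin d → ℝ) → ℝ) (ξ : Fin d → ℝ) {a : ℝ} (ha : 0 < a)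
    (v : Fin d → ℝ) (c : ℝ) (E : Set (Fin (d + 1) → ℝ)) :
    volume (patchChart F h ξ a v c '' E) =
      ENNReal.ofReal (a ^ d) * volume (patchChart F h ξ 1 0 0 '' E) := by
  let D : Fin (d + 1) → ℝ := Fin.snoc (α := fun _ => ℝ) (fun _ => a) 1
  let w : Fin (d + 1) → ℝ := Fin.snoc (α := fun _ => ℝ) (-(a • v)) (-c)
  have h1 : patchChart F h ξ a v c '' E =
      (fun x => x + w) '' (Matrix.toLin' (Matrix.diagonal D) '' (patchChart F h ξ 1 0 0 '' E)) := by
    rw [image_image, image_image]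
    refine image_congr fun y _ => ?_
    ext i
    induction i using Fin.lastCases with
    | last => simp [patchChart, D, w, Matrix.mulVec_diagonal, sub_eq_add_neg]
    | cast i => simp [patchChart, D, w, Matrix.mulVec_diagonal, sub_eq_add_neg]
  rw [h1, image_add_right, measure_preimage_add_right, Measure.addHaar_image_linearMap,
    LinearMap.det_toLin', Matrix.det_diagonal, Fin.prod_univ_castSucc]
  simp [D, abs_of_pos (pow_pos ha d)]

namespace StraightenedPatch

variable {d : ℕ} {B : Set (Fin (d + 1) → ℝ)} {U : Set (Fin d → ℝ)}
  {F : (Fin (d + 1) → ℝ) → (Fin d → ℝ) → Fin d → ℝ}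
  {h : (Fin (d + 1) → ℝ) → (Fin d → ℝ) → ℝ} {L : ℕ}

lemma volume_chart_le (hp : StraightenedPatch B U F h L) {ξ : Fin d → ℝ} (hξ : ξ ∈ U) {a : ℝ}
    (ha : 0 < a) (v : Fin d → ℝ) (c : ℝ) {E : Set (Fin (d + 1) → ℝ)} (hE : E ⊆ B) :
    volume (patchChart F h ξ a v c '' E) ≤ ENNReal.ofReal (a ^ d) * (L ^ (d + 1) * volume E) := by
  rw [volume_patchChart_image F h ξ ha]
  gcongr
  refine volume_image_le_of_lip _ _ _ fun x hx y hy => ?_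
  simp only [patchChart, one_smul, sub_zero, dist_snoc]
  refine max_le ?_ (hp.lip_h x (hE hx) y (hE hy) ξ hξ)
  simpa using hp.lip x (hE hx) y (hE hy) ξ hξ ξ hξ

lemma antilip_chart (hp : StraightenedPatch B U F h L) {ξ : Fin d → ℝ} (hξ : ξ ∈ U)
    {x y : Fin (d + 1) → ℝ} (hx : x ∈ B) (hy : y ∈ B) :
    dist x y ≤ L * dist (patchChart F h ξ 1 0 0 x) (patchChart F h ξ 1 0 0 y) := by
  simp only [patchChart, one_smul, sub_zero, dist_snoc]
  exact hp.antilip x hx y hy ξ hξ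

lemma le_volume_chart (hp : StraightenedPatch B U F h L) {ξ : Fin d → ℝ} (hξ : ξ ∈ U) {a : ℝ}
    (ha : 0 < a) (v : Fin d → ℝ) (c : ℝ) {E : Set (Fin (d + 1) → ℝ)} (hE : E ⊆ B) :
    ENNReal.ofReal (a ^ d) * volume E ≤ L ^ (d + 1) * volume (patchChart F h ξ a v c '' E) := by
  rw [volume_patchChart_image F h ξ ha, mul_left_comm]
  gcongr
  exact volume_le_of_antilip _ _ _ fun x hx y hy => hp.antilip_chart hξ (hE hx) (hE hy)

lemma measurableSet_chart (hp : StraightenedPatch B U F h L) {ξ : Fin d → ℝ} (hξ : ξ ∈ U) {a : ℝ}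
    (ha : 0 < a) (v : Fin d → ℝ) (c : ℝ) {E : Set (Fin (d + 1) → ℝ)} (hE : E ⊆ B)
    (hm : MeasurableSet E) : MeasurableSet (patchChart F h ξ a v c '' E) := by
  have hF : ContinuousOn (fun y => F y ξ) E := by
    have : LipschitzOnWith (L : NNReal) (fun y => F y ξ) E :=
      LipschitzOnWith.of_dist_le_mul fun x hx y hy => by
        simpa using hp.lip x (hE hx) y (hE hy) ξ hξ ξ hξ
    exact this.continuousOn
  have hh : ContinuousOn (fun y => h y ξ) E := by
    have : LipschitzOnWith (L : NNReal) (fun y => h y ξ) E :=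
      LipschitzOnWith.of_dist_le_mul fun x hx y hy => by
        simpa using hp.lip_h x (hE hx) y (hE hy) ξ hξ
    exact this.continuousOn
  refine hm.image_of_continuousOn_injOn ?_ ?_
  · rw [continuousOn_pi]
    intro i
    induction i using Fin.lastCases with
    | last =>
      have : ContinuousOn (fun y => h y ξ - c) E := hh.sub continuousOn_const
      simpa [patchChart] using this
    | cast i =>
      have : ContinuousOn (fun y => a * (F y ξ i - v i)) E :=
        ((continuousOn_pi.1 hF i).sub continuousOn_const).const_smul a
      simpa [patchChart] using this
  · intro x hx y hy hxy
    have h1 : dist (F x ξ) (F y ξ) = 0 ∧ dist (h x ξ) (h y ξ) = 0 := by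
      constructor
      · rw [dist_eq_zero]
        ext i
        have := congrFun hxy i.castSucc
        simpa [patchChart, ha.ne'] using this
      · rw [dist_eq_zero]
        have := congrFun hxy (Fin.last d)
        simpa [patchChart] using this
    have h2 := hp.antilip x (hE hx) y (hE hy) ξ hξ
    rw [h1.1, h1.2, max_self, mul_zero] at h2
    exact dist_le_zero.1 h2

lemma volume_tube_le (hp : StraightenedPatch B U F h L) {ξ : Fin d → ℝ} (hξ : ξ ∈ U)
    (v : Fin d → ℝ) {r : ℝ} (hr : 0 ≤ r) :
    volume {y ∈ B | dist (F y ξ) v ≤ r} ≤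
      ENNReal.ofReal (L ^ (d + 1) * ((2 * r) ^ d * 2)) := by
  rcases {y ∈ B | dist (F y ξ) v ≤ r}.eq_empty_or_nonempty with h0 | ⟨y₀, hy₀, -⟩
  · rw [h0]; simp
  have h1 := volume_le_of_antilip (patchChart F h ξ 1 0 0) {y ∈ B | dist (F y ξ) v ≤ r} L
    fun x hx y hy => hp.antilip_chart hξ hx.1 hy.1
  refine h1.trans ?_
  rw [ENNReal.ofReal_mul (by positivity), ENNReal.ofReal_pow (by positivity), ENNReal.ofReal_natCast]
  gcongr
  let lo : Fin (d + 1) → ℝ := Fin.snoc (α := fun _ => ℝ) (fun i => v i - r) (h y₀ ξ - 1)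
  let hi : Fin (d + 1) → ℝ := Fin.snoc (α := fun _ => ℝ) (fun i => v i + r) (h y₀ ξ + 1)
  have h2 : patchChart F h ξ 1 0 0 '' {y ∈ B | dist (F y ξ) v ≤ r} ⊆ Icc lo hi := by
    rintro _ ⟨y, ⟨hy, hd⟩, rfl⟩
    have ht := hp.osc_h y hy y₀ hy₀ ξ hξ
    rw [Real.dist_eq, abs_le] at ht
    constructor <;> intro i <;> induction i using Fin.lastCases with
    | last => simp [patchChart, lo, hi]; linarith
    | cast i =>
      have := (dist_le_pi_dist (F y ξ) v i).trans hd
      rw [Real.dist_eq, abs_le] at this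
      simp [patchChart, lo, hi]; linarith
  refine (measure_mono h2).trans ?_
  rw [Real.volume_Icc_pi, Fin.prod_univ_castSucc, ← ENNReal.ofReal_prod_of_nonneg,
    ← ENNReal.ofReal_mul]
  · apply le_of_eq; congr 1
    simp [lo, hi]; ring_nf
  · refine Finset.prod_nonneg fun i _ => ?_
    simp [lo, hi]; linarith
  · intro i _
    simp [lo, hi]; linarith

end StraightenedPatch

/-- Constants are absorbed by a small power as the scale tends to zero. -/
lemma eventually_mul_rpow_le (C : ℝ) {a b : ℝ} (hab : a < b) :
    ∀ᶠ ρ : ℝ in 𝓝[>] 0, C * ρ ^ b ≤ ρ ^ a := by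
  have h1 : Filter.Tendsto (fun ρ : ℝ => C * ρ ^ (b - a)) (𝓝[>] 0) (𝓝 (C * 0 ^ (b - a))) := by
    refine Filter.Tendsto.const_mul C ?_
    exact ((Real.continuous_rpow_const (sub_pos.2 hab).le).tendsto 0).mono_left nhdsWithin_le_nhds
  rw [Real.zero_rpow (sub_pos.2 hab).ne', mul_zero] at h1
  filter_upwards [h1.eventually (gt_mem_nhds one_pos), self_mem_nhdsWithin] with ρ h2 h3
  have h3 : 0 < ρ := h3
  calc C * ρ ^ b = (C * ρ ^ (b - a)) * ρ ^ a := by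
        rw [mul_assoc, ← Real.rpow_add h3]; congr 2; ring
    _ ≤ 1 * ρ ^ a := by gcongr
    _ = ρ ^ a := one_mul _

end

section

/-- Sticky Kakeya for straight tubes, in terms of the counting condition. -/
def StraightStickyKakeya (d : ℕ) : Prop :=
  ∀ ε : ℝ, 0 < ε → ∃ η : ℝ, 0 < η ∧ ∀ᶠ δ : ℝ in 𝓝[>] 0,
    ∀ P : Finset ((Fin d → ℝ) × (Fin d → ℝ)),
      (∀ p ∈ P, ‖p.1‖ ≤ 1 / 2 ∧ ‖p.2‖ ≤ 1 / 2) → SeparatedBy δ P → StickyCount P δ (δ ^ (-η)) →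
      ∀ Y : ((Fin d → ℝ) × (Fin d → ℝ)) → Set (Fin (d + 1) → ℝ),
        (∀ p ∈ P, MeasurableSet (Y p) ∧ ∀ y ∈ Y p, |y (Fin.last d)| ≤ 1 ∧
          ‖Fin.init (α := fun _ => ℝ) y + y (Fin.last d) • p.1 - p.2‖ ≤ δ) →
        ENNReal.ofReal (δ ^ η) ≤ ∑ p ∈ P, volume (Y p) →
        ENNReal.ofReal (δ ^ ε) ≤ volume (⋃ p ∈ P, Y p)

lemma gradXi_φrest (d : ℕ) (x : Fin (d + 1) → ℝ) (ξ : Fin d → ℝ) :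
    gradXi (d + 1) (φrest d) x ξ =
      (Fin.init (α := fun _ => ℝ) x + x (Fin.last d) • ξ : Fin d → ℝ) := by
  have key : ∀ j : Fin d, fderiv ℝ (φrest d x) ξ (Pi.single j (1 : ℝ)) =
      x j.castSucc + x (Fin.last d) * ξ j := by
    intro j
    have h1 : HasFDerivAt (φrest d x)
        ((∑ i : Fin d, x i.castSucc • (ContinuousLinearMap.proj i : (Fin d → ℝ) →L[ℝ] ℝ)) +
          ((1 / 2) * x (Fin.last d)) • ∑ i : Fin d,
            (2 * ξ i ^ 1) • (ContinuousLinearMap.proj i : (Fin d → ℝ) →L[ℝ] ℝ)) ξ := by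
      unfold φrest
      refine HasFDerivAt.add (HasFDerivAt.fun_sum fun i _ => ?_)
        (HasFDerivAt.const_mul (HasFDerivAt.fun_sum fun i _ => ?_) _)
      · exact (hasFDerivAt_apply i ξ).const_mul _
      · simpa using (hasFDerivAt_apply (𝕜 := ℝ) i ξ).pow 2
    rw [h1.fderiv]
    simp [Pi.single_apply]
    ring
  ext j
  exact key j

lemma straightStickyKakeya_of_SKp {d : ℕ}
    (hrest : ∀ ε : ℝ, 0 < ε → ∃ η : ℝ, 0 < η ∧ ∃ δ₀ : ℝ, 0 < δ₀ ∧
      ∀ δ : ℝ, 0 < δ → δ < δ₀ →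
        SKp (d + 1) (φrest d) univ (closedBall 0 1) (closedBall 0 1) ε η δ) :
    StraightStickyKakeya d := by
  intro ε hε
  obtain ⟨η, hη, δ₀, hδ₀, H⟩ := hrest ε hε
  refine ⟨η / 2, half_pos hη, ?_⟩
  filter_upwards [self_mem_nhdsWithin, mem_nhdsWithin_of_mem_nhds (Iio_mem_nhds hδ₀),
    mem_nhdsWithin_of_mem_nhds (Iio_mem_nhds (one_pos (α := ℝ))),
    eventually_mul_rpow_le (5 ^ d) (show -η < -(η / 2) by linarith)] with δ h0 h1 h2 h3
  have h0 : 0 < δ := h0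
  intro P hP hsep hcnt Y hY hsum
  have hmem : ∀ p ∈ P, p ∈ (closedBall (0 : Fin d → ℝ) 1) ×ˢ
      ((fun q : (Fin (d + 1) → ℝ) × (Fin d → ℝ) => gradXi (d + 1) (φrest d) q.1 q.2) ''
        (closedBall 0 1 ×ˢ closedBall 0 1)) := by
    intro p hp
    obtain ⟨h4, h5⟩ := hP p hp
    refine ⟨by simpa using h4.trans (by norm_num), (Fin.snoc (α := fun _ => ℝ) p.2 0, 0),
      ⟨?_, by simp⟩, ?_⟩
    · rw [mem_closedBall]
      have : (0 : Fin (d + 1) → ℝ) = Fin.snoc (α := fun _ => ℝ) (0 : Fin d → ℝ) 0 := by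
        ext i
        induction i using Fin.lastCases <;> simp
      rw [this, dist_snoc]
      simpa using h5.trans (by norm_num)
    · simp only [gradXi_φrest]
      simp
  refine H δ h0 h1 P hmem hsep ?_ Y ?_ (le_trans ?_ hsum)
  · intro ρ hρ
    obtain ⟨Q, hQ, hc, hn⟩ := hcnt.exists_cover h0 hsep hρ
    exact ⟨Q, fun q hq => hmem q (hQ hq), hc, fun S hS h => (hn S hS h).trans h3⟩
  · intro (p : (Fin d → ℝ) × (Fin d → ℝ)) hp
    obtain ⟨hm, hy⟩ := hY p hp
    obtain ⟨h4, h5⟩ := hP p hp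
    refine ⟨hm, fun y hyp => ?_⟩
    obtain ⟨h6, h7⟩ := hy y hyp
    refine ⟨Fin.snoc (α := fun _ => ℝ) (p.2 - y (Fin.last d) • p.1) (y (Fin.last d)),
      ⟨⟨mem_univ _, ?_⟩, ?_⟩, ?_⟩
    · simp only [gradXi_φrest]
      simp
    · rw [mem_closedBall]
      have : (0 : Fin (d + 1) → ℝ) = Fin.snoc (α := fun _ => ℝ) (0 : Fin d → ℝ) 0 := by
        ext i
        induction i using Fin.lastCases <;> simp
      rw [this, dist_snoc]
      refine max_le ?_ (by simpa using h6)
      rw [dist_zero_right]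
      calc ‖p.2 - y (Fin.last d) • p.1‖ ≤ ‖p.2‖ + ‖y (Fin.last d) • p.1‖ := norm_sub_le _ _
        _ ≤ 1 / 2 + 1 * (1 / 2) := by
          rw [norm_smul, Real.norm_eq_abs]
          gcongr
        _ = 1 := by norm_num
    · conv_lhs => rw [← Fin.snoc_init_self (α := fun _ => ℝ) y]
      rw [dist_snoc]
      simp only [Fin.snoc_last, dist_self]
      refine max_le ?_ h0.le
      rw [dist_eq_norm]
      have : Fin.init (α := fun _ => ℝ) y - (p.2 - y (Fin.last d) • p.1) =
          Fin.init (α := fun _ => ℝ) y + y (Fin.last d) • p.1 - p.2 := by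
        rw [sub_sub_eq_add_sub]
      rw [this]
      exact h7
  · apply ENNReal.ofReal_le_ofReal
    exact Real.rpow_le_rpow_of_exponent_ge h0 (le_of_lt h2) (by linarith)

end

section

/-- The affine rescaling of curve parameters that turns curves near the one with parameter `q` into
straight lines. -/
def rescaleParam {d : ℕ} (A R : (Fin d → ℝ) →ₗ[ℝ] (Fin d → ℝ)) (a : ℝ)
    (q p : (Fin d → ℝ) × (Fin d → ℝ)) : (Fin d → ℝ) × (Fin d → ℝ) :=
  (a • R (p.1 - q.1), a • ((p.2 - q.2) - A (p.1 - q.1)))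

section Rescale

variable {d : ℕ} {A R : (Fin d → ℝ) →ₗ[ℝ] (Fin d → ℝ)} {a : ℝ} {L : ℕ}

lemma rescaleParam_sub (q p p' : (Fin d → ℝ) × (Fin d → ℝ)) :
    rescaleParam A R a q p - rescaleParam A R a q p' =
      (a • R (p.1 - p'.1), a • ((p.2 - p'.2) - A (p.1 - p'.1))) := by
  simp only [rescaleParam, Prod.mk_sub_mk, map_sub, ← smul_sub, Prod.mk.injEq]
  constructor <;> congr 1 <;> abel

lemma dist_rescaleParam_le (hL : 1 ≤ L) (ha : 0 < a) (hA : ∀ x, ‖A x‖ ≤ L * ‖x‖)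
    (hR : ∀ x, ‖R x‖ ≤ L * ‖x‖) (q p p' : (Fin d → ℝ) × (Fin d → ℝ)) :
    dist (rescaleParam A R a q p) (rescaleParam A R a q p') ≤ 2 * L * a * dist p p' := by
  have hL' : (1 : ℝ) ≤ L := by exact_mod_cast hL
  rw [dist_eq_norm, rescaleParam_sub, Prod.norm_def]
  have h1 : ‖p.1 - p'.1‖ ≤ dist p p' := by rw [← dist_eq_norm]; exact le_max_left _ _
  have h2 : ‖p.2 - p'.2‖ ≤ dist p p' := by rw [← dist_eq_norm]; exact le_max_right _ _
  have h0 : 0 ≤ dist p p' := dist_nonneg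
  refine max_le ?_ ?_ <;> simp only [norm_smul, Real.norm_eq_abs, abs_of_pos ha]
  · calc a * ‖R (p.1 - p'.1)‖ ≤ a * (L * dist p p') := by
          gcongr; exact (hR _).trans (by gcongr)
      _ ≤ 2 * L * a * dist p p' := by nlinarith [mul_nonneg (mul_nonneg ha.le h0) (zero_le_one.trans hL')]
  · calc a * ‖p.2 - p'.2 - A (p.1 - p'.1)‖ ≤ a * (dist p p' + L * dist p p') := by
          gcongr
          refine (norm_sub_le _ _).trans (add_le_add h2 ((hA _).trans (by gcongr)))
      _ ≤ 2 * L * a * dist p p' := by nlinarith [mul_nonneg ha.le h0]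

lemma dist_fst_le_rescaleParam (ha : 0 < a) (hR' : ∀ x, ‖x‖ ≤ L * ‖R x‖)
    (q p p' : (Fin d → ℝ) × (Fin d → ℝ)) :
    a * dist p.1 p'.1 ≤ L * dist (rescaleParam A R a q p).1 (rescaleParam A R a q p').1 := by
  have h : (rescaleParam A R a q p).1 - (rescaleParam A R a q p').1 = a • R (p.1 - p'.1) :=
    congrArg Prod.fst (rescaleParam_sub q p p')
  rw [dist_eq_norm, dist_eq_norm, h, norm_smul, Real.norm_eq_abs, abs_of_pos ha, mul_left_comm]
  gcongr
  exact hR' _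

lemma dist_le_rescaleParam (hL : 1 ≤ L) (ha : 0 < a) (hA : ∀ x, ‖A x‖ ≤ L * ‖x‖)
    (hR' : ∀ x, ‖x‖ ≤ L * ‖R x‖) (q p p' : (Fin d → ℝ) × (Fin d → ℝ)) :
    a * dist p p' ≤ 2 * L ^ 2 * dist (rescaleParam A R a q p) (rescaleParam A R a q p') := by
  have hL' : (1 : ℝ) ≤ L := by exact_mod_cast hL
  set D := dist (rescaleParam A R a q p) (rescaleParam A R a q p') with hD
  have hD0 : 0 ≤ D := dist_nonneg
  have h1 : a * dist p.1 p'.1 ≤ L * D :=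
    (dist_fst_le_rescaleParam ha hR' q p p').trans (by gcongr; exact le_max_left _ _)
  have h2 : a * ‖p.2 - p'.2 - A (p.1 - p'.1)‖ ≤ D := by
    have h : (rescaleParam A R a q p).2 - (rescaleParam A R a q p').2 =
        a • ((p.2 - p'.2) - A (p.1 - p'.1)) := congrArg Prod.snd (rescaleParam_sub q p p')
    have h3 : dist (rescaleParam A R a q p).2 (rescaleParam A R a q p').2 ≤ D := le_max_right _ _
    rwa [dist_eq_norm, h, norm_smul, Real.norm_eq_abs, abs_of_pos ha] at h3
  have h3 : dist p.2 p'.2 ≤ ‖p.2 - p'.2 - A (p.1 - p'.1)‖ + L * dist p.1 p'.1 := by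
    rw [dist_eq_norm, dist_eq_norm]
    calc ‖p.2 - p'.2‖ = ‖(p.2 - p'.2 - A (p.1 - p'.1)) + A (p.1 - p'.1)‖ := by
          rw [sub_add_cancel]
      _ ≤ _ := (norm_add_le _ _).trans (by gcongr; exact hA _)
  have h4 : a * dist p.2 p'.2 ≤ D + L * (L * D) := by
    calc _ ≤ a * (‖p.2 - p'.2 - A (p.1 - p'.1)‖ + L * dist p.1 p'.1) := by gcongr
      _ = a * ‖p.2 - p'.2 - A (p.1 - p'.1)‖ + L * (a * dist p.1 p'.1) := by ring
      _ ≤ _ := by gcongr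
  have h5 : D ≤ L ^ 2 * D := le_mul_of_one_le_left hD0 (one_le_pow₀ hL')
  have h6 : (L : ℝ) * D ≤ L ^ 2 * D := by
    rw [pow_two, mul_assoc]; exact le_mul_of_one_le_left (by positivity) hL'
  rcases max_choice (dist p.1 p'.1) (dist p.2 p'.2) with h | h <;>
    rw [Prod.dist_eq, h] <;> nlinarith

/-- In rescaled coordinates, curves through a common coarse tube are close to straight lines. -/
lemma norm_chart_add_smul_sub_le {B : Set (Fin (d + 1) → ℝ)} {U : Set (Fin d → ℝ)}
    {F : (Fin (d + 1) → ℝ) → (Fin d → ℝ) → Fin d → ℝ}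
    {h : (Fin (d + 1) → ℝ) → (Fin d → ℝ) → ℝ} {K : ℕ} {ρ : ℝ} (hp : StraightenedPatch B U F h L)
    (hρ : 0 < ρ) (hρ1 : ρ ≤ 1) (ha : 0 < a) (haρ : a * ρ ≤ 1)
    {q p p₀ : (Fin d → ℝ) × (Fin d → ℝ)} {y y₀ : Fin (d + 1) → ℝ}
    (hq : q.1 ∈ U) (hpU : p.1 ∈ U) (hp₀U : p₀.1 ∈ U) (hy : y ∈ B) (hy₀ : y₀ ∈ B)
    (hpq : dist p q ≤ ρ) (hp₀q : dist p₀ q ≤ ρ)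
    (hyp : dist (F y p.1) p.2 ≤ K * ρ ^ 2) (hyp₀ : dist (F y₀ p₀.1) p₀.2 ≤ K * ρ ^ 2)
    (happ : ‖F y p.1 - F y q.1 - A (p.1 - q.1) - (h y q.1 - h y₀ q.1) • R (p.1 - q.1)‖ ≤
        L * (‖p.1 - q.1‖ + dist (F y q.1) (F y₀ q.1)) * ‖p.1 - q.1‖) :
    ‖a • (F y q.1 - q.2) + (h y q.1 - h y₀ q.1) • (rescaleParam A R a q p).1 -
        (rescaleParam A R a q p).2‖ ≤ (K + L * (1 + 2 * (K + 2 * L)) : ℕ) * ρ := by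
  have hL' : (1 : ℝ) ≤ L := by exact_mod_cast hp.one_le
  have key : ∀ (p : (Fin d → ℝ) × (Fin d → ℝ)) (y : Fin (d + 1) → ℝ), p.1 ∈ U → y ∈ B →
      dist p q ≤ ρ → dist (F y p.1) p.2 ≤ K * ρ ^ 2 → dist (F y q.1) q.2 ≤ (K + 2 * L) * ρ := by
    intro p y hpU hy hpq hyp
    have h1 : dist p.1 q.1 ≤ ρ := (le_max_left _ _).trans hpq
    have h2 : dist p.2 q.2 ≤ ρ := (le_max_right _ _).trans hpq
    have h3 := hp.lip y hy y hy q.1 hq p.1 hpU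
    rw [dist_self, zero_add, dist_comm q.1] at h3
    have h4 := dist_triangle4 (F y q.1) (F y p.1) p.2 q.2
    have h5 : (L : ℝ) * dist p.1 q.1 ≤ L * ρ := by gcongr
    have h6 : (K : ℝ) * ρ ^ 2 ≤ K * ρ := by
      gcongr; nlinarith
    nlinarith
  have h1 := key p y hpU hy hpq hyp
  have h2 := key p₀ y₀ hp₀U hy₀ hp₀q hyp₀
  have h3 : dist (F y q.1) (F y₀ q.1) ≤ 2 * (K + 2 * L) * ρ := by
    have := dist_triangle_right (F y q.1) (F y₀ q.1) q.2
    linarith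
  have h4 : ‖p.1 - q.1‖ ≤ ρ := by rw [← dist_eq_norm]; exact (le_max_left _ _).trans hpq
  have h5 : ‖F y p.1 - F y q.1 - A (p.1 - q.1) - (h y q.1 - h y₀ q.1) • R (p.1 - q.1)‖ ≤
      L * (ρ + 2 * (K + 2 * L) * ρ) * ρ := happ.trans (by gcongr)
  have h6 : a • (F y q.1 - q.2) + (h y q.1 - h y₀ q.1) • (rescaleParam A R a q p).1 -
        (rescaleParam A R a q p).2 =
      a • ((F y p.1 - p.2) -
        (F y p.1 - F y q.1 - A (p.1 - q.1) - (h y q.1 - h y₀ q.1) • R (p.1 - q.1))) := by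
    simp only [rescaleParam]
    ext i
    simp
    ring
  rw [h6, norm_smul, Real.norm_eq_abs, abs_of_pos ha]
  rw [dist_eq_norm] at hyp
  calc _ ≤ a * (K * ρ ^ 2 + L * (ρ + 2 * (K + 2 * L) * ρ) * ρ) := by
        gcongr
        exact (norm_sub_le _ _).trans (add_le_add hyp h5)
    _ = (a * ρ) * ((K + L * (1 + 2 * (K + 2 * L))) * ρ) := by ring
    _ ≤ 1 * ((K + L * (1 + 2 * (K + 2 * L))) * ρ) := by gcongr
    _ = _ := by push_cast; ring

end Rescale

end

section

lemma stickyCount_image_rescaleParam {d : ℕ} {A R : (Fin d → ℝ) →ₗ[ℝ] (Fin d → ℝ)} {L C : ℕ}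
    {ρ N : ℝ} (hL : 1 ≤ L) (hC : 1 ≤ C) (hρ : 0 < ρ) (hρ1 : ρ ≤ 1 / 2)
    (hA : ∀ x, ‖A x‖ ≤ L * ‖x‖) (hR : ∀ x, ‖R x‖ ≤ L * ‖x‖) (hR' : ∀ x, ‖x‖ ≤ L * ‖R x‖)
    (q : (Fin d → ℝ) × (Fin d → ℝ)) [DecidableEq ((Fin d → ℝ) × (Fin d → ℝ))]
    {P : Finset ((Fin d → ℝ) × (Fin d → ℝ))} (h : StickyCount P (ρ ^ 2) N) :
    StickyCount (P.image (rescaleParam A R (1 / (4 * L * ρ)) q)) (C * ρ)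
      ((2 * (2 * L ^ 2 : ℕ) + 1) ^ d * N) := by
  have hL' : (1 : ℝ) ≤ L := by exact_mod_cast hL
  have hC' : (1 : ℝ) ≤ C := by exact_mod_cast hC
  have ha : 0 < 1 / (4 * L * ρ) := by positivity
  set a := 1 / (4 * L * ρ) with ha_def
  set ψ := rescaleParam A R a q with hψ
  have haρ : a * (4 * L * ρ) = 1 := by rw [ha_def]; field_simp
  have hinj : Function.Injective ψ := by
    intro p p' hpp
    have := dist_le_rescaleParam hL ha hA hR' q p p'
    rw [← hψ, hpp, dist_self, mul_zero] at this
    exact dist_le_zero.1 (nonpos_of_mul_nonpos_right this ha)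
  intro σ hσ S hS hsep hpar
  obtain ⟨T, hT, rfl⟩ := Finset.subset_image_iff.1 hS
  rw [Finset.card_image_of_injective _ hinj]
  have hσ0 : 0 < σ := by
    have : 0 < C * ρ := by positivity
    linarith [hσ.1]
  have hσρ : ρ ≤ σ := by
    have : 1 * ρ ≤ C * ρ := by gcongr
    linarith [hσ.1]
  refine h.card_le (σ := 2 * ρ * σ) (by positivity) ⟨?_, ?_⟩ hT ?_ (2 * L ^ 2) ?_
  · nlinarith
  · nlinarith [hσ.2]
  · intro p hp p' hp' hne
    have h1 := hsep (ψ p) (Finset.mem_image_of_mem _ hp) (ψ p') (Finset.mem_image_of_mem _ hp')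
      (hinj.ne hne)
    have h2 := dist_rescaleParam_le hL ha hA hR q p p'
    have h3 : 2 * ρ * σ ≤ 2 * ρ * (2 * L * a * dist p p') := by gcongr; exact h1.trans h2
    calc _ ≤ _ := h3
      _ = (a * (4 * L * ρ)) * dist p p' := by ring
      _ = _ := by rw [haρ, one_mul]
  · intro p hp p' hp'
    have h1 := hpar (ψ p) (Finset.mem_image_of_mem _ hp) (ψ p') (Finset.mem_image_of_mem _ hp')
    have h2 := dist_fst_le_rescaleParam (A := A) ha hR' q p p'
    calc dist p.1 p'.1 = (4 * L * ρ) * (a * dist p.1 p'.1) := by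
          rw [← mul_assoc, mul_comm (4 * L * ρ), haρ, one_mul]
      _ ≤ (4 * L * ρ) * (L * σ) := by
          refine mul_le_mul_of_nonneg_left (h2.trans ?_) (by positivity)
          exact mul_le_mul_of_nonneg_left h1 (by positivity)
      _ = _ := by push_cast; ring

/-- The curves inside a single tube of radius `ρ` fill out most of that tube at scale `ρ ^ 2`. -/
lemma StraightenedPatch.volume_fiber {d : ℕ} {B : Set (Fin (d + 1) → ℝ)} {U : Set (Fin d → ℝ)}
    {F : (Fin (d + 1) → ℝ) → (Fin d → ℝ) → Fin d → ℝ}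
    {h : (Fin (d + 1) → ℝ) → (Fin d → ℝ) → ℝ} {L : ℕ} (hp : StraightenedPatch B U F h L)
    (hS : StraightStickyKakeya d) (K : ℕ) {ε : ℝ} (hε : 0 < ε) :
    ∃ η : ℝ, 0 < η ∧ ∀ᶠ ρ : ℝ in 𝓝[>] 0, ∀ q : (Fin d → ℝ) × (Fin d → ℝ), q.1 ∈ U →
      ∀ P : Finset ((Fin d → ℝ) × (Fin d → ℝ)), (∀ p ∈ P, p.1 ∈ U ∧ dist p q ≤ ρ) →
      SeparatedBy (ρ ^ 2) P → StickyCount P (ρ ^ 2) (ρ ^ (-η)) →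
      ∀ Y : ((Fin d → ℝ) × (Fin d → ℝ)) → Set (Fin (d + 1) → ℝ),
      (∀ p ∈ P, MeasurableSet (Y p) ∧ Y p ⊆ {y ∈ B | dist (F y p.1) p.2 ≤ K * ρ ^ 2}) →
      ENNReal.ofReal (ρ ^ η * ρ ^ d) ≤ ∑ p ∈ P, volume (Y p) →
      ENNReal.ofReal (ρ ^ ε * ρ ^ d) ≤ volume (⋃ p ∈ P, Y p) := by
  classical
  obtain ⟨η', hη', H⟩ := hS (ε / 2) (half_pos hε)
  have hL := hp.one_le
  have hL' : (1 : ℝ) ≤ L := by exact_mod_cast hL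
  let C : ℕ := K + L * (1 + 2 * (K + 2 * L))
  have hC : 1 ≤ C := by
    have : 1 * 1 ≤ L * (1 + 2 * (K + 2 * L)) := Nat.mul_le_mul hL (by omega)
    omega
  have hC' : (1 : ℝ) ≤ C := by exact_mod_cast hC
  let R₀ : ℕ := 8 * L ^ 3 * C
  let D : ℕ := (2 * (4 * R₀) + 1) ^ d * (2 * (4 * R₀) + 1) ^ d
  have hR₀ : 1 ≤ R₀ := Nat.succ_le_of_lt (by positivity)
  have hR₀' : (1 : ℝ) ≤ R₀ := by exact_mod_cast hR₀
  have hCρ : Filter.Tendsto (fun ρ : ℝ => (C : ℝ) * ρ) (𝓝[>] 0) (𝓝[>] 0) := by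
    refine tendsto_nhdsWithin_iff.2 ⟨?_, ?_⟩
    · have : Filter.Tendsto (fun ρ : ℝ => (C : ℝ) * ρ) (𝓝 0) (𝓝 (C * 0)) :=
        (continuous_const.mul continuous_id).tendsto 0
      rw [mul_zero] at this
      exact this.mono_left nhdsWithin_le_nhds
    · filter_upwards [self_mem_nhdsWithin] with ρ hρ
      have hρ : 0 < ρ := hρ
      show 0 < (C : ℝ) * ρ
      positivity
  refine ⟨η' / 2, half_pos hη', ?_⟩
  filter_upwards [self_mem_nhdsWithin,
    mem_nhdsWithin_of_mem_nhds (Iio_mem_nhds (show (0 : ℝ) < 1 / 2 by norm_num)),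
    hCρ.eventually H,
    eventually_mul_rpow_le ((2 * (2 * L ^ 2 : ℕ) + 1) ^ d * (C : ℝ) ^ η')
      (show -η' < -(η' / 2) by linarith),
    eventually_mul_rpow_le ((4 * L) ^ d * (D * L ^ (d + 1) * (C : ℝ) ^ η'))
      (show η' / 2 < η' by linarith),
    eventually_mul_rpow_le (L ^ (d + 1)) (show ε / 2 < ε by linarith)] with
    ρ hρ hρ2 hsk hN hsm hend
  have hρ : 0 < ρ := hρ
  have hρ2 : ρ < 1 / 2 := hρ2
  intro q hq P hPU hsep hcnt Y hY hsum
  set a := 1 / (4 * L * ρ) with ha_def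
  have ha : 0 < a := by positivity
  have haρ : a * (4 * L * ρ) = 1 := by rw [ha_def]; field_simp
  have haρ1 : a * ρ ≤ 1 := by
    have : a * ρ ≤ a * (4 * L * ρ) := by
      gcongr; nlinarith
    linarith
  -- a base point on the tube
  have hex : ∃ p₀ ∈ P, ∃ y₀, y₀ ∈ Y p₀ := by
    by_contra hcon
    push Not at hcon
    have : ∑ p ∈ P, volume (Y p) = 0 := by
      refine Finset.sum_eq_zero fun p hpP => ?_
      rw [eq_empty_of_forall_notMem (hcon p hpP), measure_empty]
    rw [this, nonpos_iff_eq_zero, ENNReal.ofReal_eq_zero] at hsum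
    have : 0 < ρ ^ (η' / 2) * ρ ^ d := by positivity
    linarith
  obtain ⟨p₀, hp₀, y₀, hy₀⟩ := hex
  have hy₀B := ((hY p₀ hp₀).2 hy₀).1
  have hy₀p := ((hY p₀ hp₀).2 hy₀).2
  obtain ⟨A, R, hA, hR, hR', happ⟩ := hp.approx q.1 hq y₀ hy₀B
  set ψ := rescaleParam A R a q with hψ
  have hinj : Function.Injective ψ := by
    intro p p' hpp
    have := dist_le_rescaleParam hL ha hA hR' q p p'
    rw [← hψ, hpp, dist_self, mul_zero] at this
    exact dist_le_zero.1 (nonpos_of_mul_nonpos_right this ha)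
  -- pass to a more separated subfamily
  have hr : 0 < R₀ * ρ ^ 2 := by positivity
  obtain ⟨P', hP', hsep', hw⟩ := exists_sep_weight P (fun p => volume (Y p)) D hr (by
    intro S hSP p hpP hS
    have := card_le_of_sep S (4 * R₀) (σ := ρ ^ 2) (by positivity) (hsep.mono hSP) (by
      intro x hx y hy
      have := dist_triangle_left x y p
      have := hS x hx
      have := hS y hy
      push_cast
      linarith)
    have h2 : (S.card : ℝ) ≤ (D : ℝ) := by
      refine this.trans (le_of_eq ?_)
      simp only [D]; push_cast; ring
    exact_mod_cast h2)
  let Φ := patchChart F h q.1 a q.2 (h y₀ q.1)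
  let g := Function.invFun ψ
  have hg : ∀ p, g (ψ p) = p := Function.leftInverse_invFun hinj
  have hYB : ∀ p ∈ P, Y p ⊆ B := fun p hpP y hy => ((hY p hpP).2 hy).1
  have hmain := hsk (P'.image ψ) ?_ ?_ ?_ (fun z => Φ '' Y (g z)) ?_ ?_
  · have hU : (⋃ z ∈ P'.image ψ, Φ '' Y (g z)) ⊆ Φ '' ⋃ p ∈ P, Y p := by
      intro x hx
      simp only [mem_iUnion, Finset.mem_image, exists_prop] at hx
      obtain ⟨_, ⟨p, hpP, rfl⟩, hx⟩ := hx
      rw [hg] at hx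
      exact image_mono (subset_biUnion_of_mem (u := Y) (hP' hpP)) hx
    have h1 := hmain.trans (measure_mono hU)
    have h2 := h1.trans (hp.volume_chart_le hq ha q.2 (h y₀ q.1) (iUnion₂_subset hYB))
    have hc : ENNReal.ofReal (a ^ d) * ((L : ENNReal) ^ (d + 1) * volume (⋃ p ∈ P, Y p)) =
        ENNReal.ofReal (a ^ d * L ^ (d + 1)) * volume (⋃ p ∈ P, Y p) := by
      rw [← mul_assoc, ENNReal.ofReal_mul (by positivity)]
      congr 2
      rw [ENNReal.ofReal_pow (by positivity), ENNReal.ofReal_natCast]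
    rw [hc] at h2
    have hpos : 0 < a ^ d * (L : ℝ) ^ (d + 1) := by positivity
    rw [← ENNReal.mul_le_mul_iff_right (a := ENNReal.ofReal (a ^ d * L ^ (d + 1)))
      (by simpa using hpos) ENNReal.ofReal_ne_top]
    refine le_trans ?_ h2
    rw [← ENNReal.ofReal_mul hpos.le]
    apply ENNReal.ofReal_le_ofReal
    calc a ^ d * L ^ (d + 1) * (ρ ^ ε * ρ ^ d) = (a * ρ) ^ d * (L ^ (d + 1) * ρ ^ ε) := by ring
      _ ≤ 1 * (L ^ (d + 1) * ρ ^ ε) := by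
          gcongr; exact pow_le_one₀ (by positivity) haρ1
      _ ≤ ρ ^ (ε / 2) := by rw [one_mul]; exact hend
      _ ≤ (C * ρ) ^ (ε / 2) := by
          apply Real.rpow_le_rpow hρ.le _ (by positivity)
          nlinarith
  · intro z hz
    obtain ⟨p, hpP, rfl⟩ := Finset.mem_image.1 hz
    have h1 := dist_rescaleParam_le hL ha hA hR q p q
    have h2 : rescaleParam A R a q q = 0 := by simp [rescaleParam]
    rw [h2, dist_zero_right] at h1
    have h3 : 2 * L * a * dist p q ≤ 2 * L * a * ρ := by gcongr; exact (hPU p (hP' hpP)).2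
    have h4 : ‖ψ p‖ ≤ 1 / 2 := by
      have : 2 * L * a * ρ = (a * (4 * L * ρ)) / 2 := by ring
      rw [this, haρ] at h3
      exact h1.trans h3
    exact ⟨(norm_fst_le _).trans h4, (norm_snd_le _).trans h4⟩
  · intro z hz z' hz' hne
    obtain ⟨p, hpP, rfl⟩ := Finset.mem_image.1 hz
    obtain ⟨p', hpP', rfl⟩ := Finset.mem_image.1 hz'
    have h1 := hsep' p hpP p' hpP' (fun h => hne (by rw [h]))
    have h2 := dist_le_rescaleParam hL ha hA hR' q p p'
    have h3 : a * (R₀ * ρ ^ 2) ≤ 2 * L ^ 2 * dist (ψ p) (ψ p') := le_trans (by gcongr) h2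
    have h4 : a * (R₀ * ρ ^ 2) = 2 * L ^ 2 * (C * ρ) := by
      have : a * (R₀ * ρ ^ 2) = (a * (4 * L * ρ)) * (2 * L ^ 2 * (C * ρ)) := by
        simp only [R₀]; push_cast; ring
      rw [this, haρ, one_mul]
    rw [h4] at h3
    exact le_of_mul_le_mul_left h3 (by positivity)
  · refine (stickyCount_image_rescaleParam hL hC hρ hρ2.le hA hR hR' q
      (hcnt.mono hP' le_rfl le_rfl)).mono subset_rfl le_rfl ?_
    rw [Real.mul_rpow (by positivity) hρ.le, Real.rpow_neg (by positivity : (0 : ℝ) ≤ C),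
      inv_mul_eq_div, le_div_iff₀ (by positivity)]
    calc _ = (2 * (2 * L ^ 2 : ℕ) + 1) ^ d * (C : ℝ) ^ η' * ρ ^ (-(η' / 2)) := by ring
      _ ≤ _ := hN
  · intro z hz
    obtain ⟨p, hpP, rfl⟩ := Finset.mem_image.1 hz
    rw [hg]
    refine ⟨hp.measurableSet_chart hq ha _ _ (hYB p (hP' hpP)) (hY p (hP' hpP)).1, ?_⟩
    rintro _ ⟨y, hy, rfl⟩
    obtain ⟨hyB, hyp⟩ := (hY p (hP' hpP)).2 hy
    obtain ⟨hpU, hpq⟩ := hPU p (hP' hpP)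
    obtain ⟨hpU₀, hpq₀⟩ := hPU p₀ hp₀
    constructor
    · simpa [Φ, patchChart, Real.dist_eq] using hp.osc_h y hyB y₀ hy₀B q.1 hq
    · simp only [Φ, patchChart, Fin.init_snoc, Fin.snoc_last]
      exact norm_chart_add_smul_sub_le hp hρ (by linarith) ha haρ1 hq hpU hpU₀ hyB hy₀B hpq hpq₀
        hyp hy₀p (happ y hyB p.1 hpU)
  · rw [Finset.sum_image fun x _ y _ hxy => hinj hxy]
    simp only [hg]
    have h1 : ∀ p ∈ P', ENNReal.ofReal (a ^ d) * volume (Y p) ≤ L ^ (d + 1) * volume (Φ '' Y p) :=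
      fun p hpP => hp.le_volume_chart hq ha _ _ (hYB p (hP' hpP))
    have h2 : ENNReal.ofReal (a ^ d) * ENNReal.ofReal (ρ ^ (η' / 2) * ρ ^ d) ≤
        ENNReal.ofReal (D * L ^ (d + 1)) * ∑ p ∈ P', volume (Φ '' Y p) := by
      calc _ ≤ ENNReal.ofReal (a ^ d) * (D * ∑ p ∈ P', volume (Y p)) := by
            gcongr; exact hsum.trans hw
        _ = D * ∑ p ∈ P', ENNReal.ofReal (a ^ d) * volume (Y p) := by
            rw [Finset.mul_sum, Finset.mul_sum, Finset.mul_sum]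
            exact Finset.sum_congr rfl fun p _ => by ring
        _ ≤ D * ∑ p ∈ P', L ^ (d + 1) * volume (Φ '' Y p) := by
            exact mul_le_mul_right (Finset.sum_le_sum fun p hpP => h1 p hpP) _
        _ = _ := by
            rw [← Finset.mul_sum, ← mul_assoc, ENNReal.ofReal_mul (by positivity),
              ENNReal.ofReal_pow (by positivity), ENNReal.ofReal_natCast, ENNReal.ofReal_natCast]
    rw [← ENNReal.ofReal_mul (by positivity)] at h2
    have hDpos : 0 < (D : ℝ) * (L : ℝ) ^ (d + 1) := by positivity
    rw [← ENNReal.mul_le_mul_iff_right (a := ENNReal.ofReal (D * L ^ (d + 1)))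
      (ENNReal.ofReal_pos.2 hDpos).ne' ENNReal.ofReal_ne_top]
    refine le_trans ?_ h2
    rw [← ENNReal.ofReal_mul hDpos.le]
    apply ENNReal.ofReal_le_ofReal
    have h4L : 0 < (4 * (L : ℝ)) ^ d := by positivity
    refine le_of_mul_le_mul_left ?_ h4L
    rw [Real.mul_rpow (by positivity) hρ.le]
    calc _ = (4 * L) ^ d * (D * L ^ (d + 1) * (C : ℝ) ^ η') * ρ ^ η' := by ring
      _ ≤ ρ ^ (η' / 2) := hsm
      _ = (a * (4 * L * ρ)) ^ d * ρ ^ (η' / 2) := by rw [haρ]; simp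
      _ = _ := by clear_value a; ring

end

section

lemma StickyCount.card_le_of_diam {d : ℕ} {P S : Finset ((Fin d → ℝ) × (Fin d → ℝ))} {δ N σ r : ℝ}
    (h : StickyCount P δ N) (hδ : 0 < δ) (hσ : σ ∈ Icc δ 1) (hS : S ⊆ P) (hsep : SeparatedBy σ S)
    (hσr : σ ≤ r) (hr : ∀ q ∈ S, ∀ q' ∈ S, dist q.1 q'.1 ≤ r) :
    (S.card : ℝ) ≤ (5 * (r / σ)) ^ d * N := by
  have hσ0 : 0 < σ := hδ.trans_le hσ.1
  have hN : 0 ≤ N := by simpa using h σ hσ ∅ (by simp) (by simp [SeparatedBy]) (by simp)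
  have h1 : 1 ≤ r / σ := (one_le_div hσ0).2 hσr
  refine (h.card_le hδ hσ hS hsep ⌈r / σ⌉₊ fun q hq q' hq' => (hr q hq q' hq').trans ?_).trans ?_
  · rw [← div_le_iff₀ hσ0]
    exact Nat.le_ceil _
  · gcongr
    have := (Nat.ceil_lt_add_one (zero_le_one.trans h1)).le
    linarith

section Cells

variable {X ι : Type*} [MeasurableSpace X] [MeasurableSpace ι] [Countable ι]
  [MeasurableSingletonClass ι]

lemma measure_eq_tsum_cells (μ : Measure X) {c : X → ι} (hc : Measurable c) (S : Set X) :
    μ S = ∑' z, μ (c ⁻¹' {z} ∩ S) := by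
  have h1 : (μ.restrict S) univ = ∑' z, (μ.restrict S) (c ⁻¹' {z}) := by
    rw [← measure_iUnion (fun i j hij => Disjoint.preimage _ (by simpa using hij))
      fun i => hc (measurableSet_singleton i), ← preimage_iUnion, iUnion_singleton_eq_range]
    simp
  rw [Measure.restrict_apply_univ] at h1
  rw [h1]
  exact tsum_congr fun z => Measure.restrict_apply (hc (measurableSet_singleton z))

/-- A set occupies at least a proportion `θ` of the union of the cells in which it has
density at least `θ`. -/
lemma mul_measure_denseCells_le (μ : Measure X) {c : X → ι} (hc : Measurable c) (B E : Set X)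
    (θ : ENNReal) :
    θ * μ {y ∈ B | θ * μ (c ⁻¹' {c y} ∩ B) ≤ μ (c ⁻¹' {c y} ∩ E)} ≤ μ E := by
  rw [measure_eq_tsum_cells μ hc E, measure_eq_tsum_cells μ hc {y ∈ B | _}, ← ENNReal.tsum_mul_left]
  refine ENNReal.tsum_le_tsum fun z => ?_
  by_cases hz : θ * μ (c ⁻¹' {z} ∩ B) ≤ μ (c ⁻¹' {z} ∩ E)
  · refine le_trans ?_ hz
    gcongr
    exact fun y hy => hy.1
  · have : c ⁻¹' {z} ∩ {y ∈ B | θ * μ (c ⁻¹' {c y} ∩ B) ≤ μ (c ⁻¹' {c y} ∩ E)} = ∅ := by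
      refine eq_empty_of_forall_notMem ?_
      rintro y ⟨rfl, hy⟩
      exact hz hy.2
    simp [this]

/-- A subset `E'` of `E` has little mass outside of the cells in which `E` has density at
least `θ`. -/
lemma measure_le_add_of_cells (μ : Measure X) {c : X → ι} (hc : Measurable c) {B E E' : Set X}
    (hE' : E' ⊆ E) (hB : E' ⊆ B) (θ : ENNReal) :
    μ E' ≤ μ {y ∈ B | θ * μ (c ⁻¹' {c y} ∩ B) ≤ μ (c ⁻¹' {c y} ∩ E) ∧ ∃ y' ∈ E', c y' = c y} +
      θ * μ {y ∈ B | ∃ y' ∈ E', c y' = c y} := by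
  rw [measure_eq_tsum_cells μ hc E', measure_eq_tsum_cells μ hc {y ∈ B | _ ∧ _},
    measure_eq_tsum_cells μ hc {y ∈ B | ∃ _, _}, ← ENNReal.tsum_mul_left, ← ENNReal.tsum_add]
  refine ENNReal.tsum_le_tsum fun z => ?_
  rcases (c ⁻¹' {z} ∩ E').eq_empty_or_nonempty with h0 | ⟨y', rfl, hy'⟩
  · simp [h0]
  by_cases hz : θ * μ (c ⁻¹' {c y'} ∩ B) ≤ μ (c ⁻¹' {c y'} ∩ E)
  · refine le_add_right (measure_mono ?_)
    rintro y ⟨hy, hyE⟩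
    have hy : c y = c y' := hy
    refine ⟨hy, hB hyE, ?_, y', hy', hy.symm⟩
    rwa [hy]
  · refine le_add_left ((measure_mono (inter_subset_inter_right _ hE')).trans ((not_le.1 hz).le.trans ?_))
    refine mul_le_mul_right (measure_mono ?_) _
    rintro y ⟨hy, hyB⟩
    have hy : c y = c y' := hy
    exact ⟨hy, hyB, y', hy', hy.symm⟩

end Cells

/-- The cell of the cubical grid of side `ρ` that contains a point. -/
noncomputable def gridCell {k : ℕ} (ρ : ℝ) (y : Fin k → ℝ) : Fin k → ℤ := fun i => ⌊y i / ρ⌋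

lemma measurable_gridCell {k : ℕ} (ρ : ℝ) : Measurable (gridCell (k := k) ρ) :=
  measurable_pi_lambda _ fun i => ((measurable_pi_apply i : Measurable fun y : Fin k → ℝ => y i).div_const ρ).floor

lemma dist_le_of_gridCell_eq {k : ℕ} {ρ : ℝ} (hρ : 0 < ρ) {y y' : Fin k → ℝ}
    (h : gridCell ρ y = gridCell ρ y') : dist y y' ≤ ρ := by
  refine (dist_pi_le_iff hρ.le).2 fun i => ?_
  have h1 := (Int.abs_sub_lt_one_of_floor_eq_floor (congrFun h i)).le
  rwa [← sub_div, abs_div, abs_of_pos hρ, div_le_one hρ, ← Real.dist_eq] at h1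

end

section

/-- The sticky Kakeya bound with exponent `ε` for shadings contained in a patch. -/
def PatchKakeya {d : ℕ} (B : Set (Fin (d + 1) → ℝ)) (U : Set (Fin d → ℝ))
    (F : (Fin (d + 1) → ℝ) → (Fin d → ℝ) → Fin d → ℝ) (K : ℕ) (ε : ℝ) : Prop :=
  ∃ η : ℝ, 0 < η ∧ ∀ᶠ δ : ℝ in 𝓝[>] 0, ∀ P : Finset ((Fin d → ℝ) × (Fin d → ℝ)),
    (∀ p ∈ P, p.1 ∈ U) → SeparatedBy δ P → StickyCount P δ (δ ^ (-η)) →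
    ∀ Y : ((Fin d → ℝ) × (Fin d → ℝ)) → Set (Fin (d + 1) → ℝ),
    (∀ p ∈ P, MeasurableSet (Y p) ∧ Y p ⊆ {y ∈ B | dist (F y p.1) p.2 ≤ K * δ}) →
    ENNReal.ofReal (δ ^ η) ≤ ∑ p ∈ P, volume (Y p) →
    ENNReal.ofReal (δ ^ ε) ≤ volume (⋃ p ∈ P, Y p)

variable {d : ℕ} {B : Set (Fin (d + 1) → ℝ)} {U : Set (Fin d → ℝ)}
  {F : (Fin (d + 1) → ℝ) → (Fin d → ℝ) → Fin d → ℝ}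
  {h : (Fin (d + 1) → ℝ) → (Fin d → ℝ) → ℝ} {L : ℕ}

lemma PatchKakeya.mono {K : ℕ} {ε ε' : ℝ} (hK : PatchKakeya B U F K ε) (hε : ε ≤ ε') :
    PatchKakeya B U F K ε' := by
  obtain ⟨η, hη, H⟩ := hK
  refine ⟨η, hη, ?_⟩
  filter_upwards [H, self_mem_nhdsWithin,
    mem_nhdsWithin_of_mem_nhds (Iio_mem_nhds (one_pos : (0 : ℝ) < 1))] with δ h0 h1 h2
  intro P hP hs hc Y hY hsum
  refine le_trans (ENNReal.ofReal_le_ofReal ?_) (h0 P hP hs hc Y hY hsum)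
  exact Real.rpow_le_rpow_of_exponent_ge h1 (le_of_lt h2) hε

lemma StraightenedPatch.patchKakeya_of_large (hp : StraightenedPatch B U F h L) (K : ℕ) :
    PatchKakeya B U F K (d + 1) := by
  refine ⟨1 / 4, by norm_num, ?_⟩
  filter_upwards [self_mem_nhdsWithin,
    mem_nhdsWithin_of_mem_nhds (Iio_mem_nhds (one_pos : (0 : ℝ) < 1)),
    eventually_mul_rpow_le (5 ^ d) (show (d : ℝ) + 1 / 2 < d + 1 by linarith)] with δ hδ hδ1 hsm
  have hδ : 0 < δ := hδ
  have hδ1 : δ < 1 := hδ1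
  intro P hP hs hc Y hY hsum
  have hcard := hc.card_le_of_diam (σ := δ) (r := 1) hδ ⟨le_rfl, hδ1.le⟩ subset_rfl hs hδ1.le
    fun q hq q' hq' => hp.dist_param_le _ (hP q hq) _ (hP q' hq')
  have h1 : ∑ p ∈ P, volume (Y p) ≤
      ENNReal.ofReal ((5 * (1 / δ)) ^ d * δ ^ (-(1 / 4) : ℝ)) * volume (⋃ p ∈ P, Y p) := by
    calc _ ≤ ∑ p ∈ P, volume (⋃ p ∈ P, Y p) :=
          Finset.sum_le_sum fun p hpP => measure_mono (subset_biUnion_of_mem (u := Y) hpP)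
      _ = ENNReal.ofReal P.card * volume (⋃ p ∈ P, Y p) := by
          rw [Finset.sum_const, nsmul_eq_mul, ENNReal.ofReal_natCast]
      _ ≤ _ := by gcongr
  have hpos : 0 < (5 * (1 / δ)) ^ d * δ ^ (-(1 / 4) : ℝ) := by positivity
  rw [← ENNReal.mul_le_mul_iff_right (a := ENNReal.ofReal ((5 * (1 / δ)) ^ d * δ ^ (-(1 / 4) : ℝ)))
    (ENNReal.ofReal_pos.2 hpos).ne' ENNReal.ofReal_ne_top]
  refine le_trans ?_ (hsum.trans h1)
  rw [← ENNReal.ofReal_mul hpos.le]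
  apply ENNReal.ofReal_le_ofReal
  calc (5 * (1 / δ)) ^ d * δ ^ (-(1 / 4) : ℝ) * δ ^ ((d : ℝ) + 1)
      = (1 / δ) ^ d * δ ^ (-(1 / 4) : ℝ) * (5 ^ d * δ ^ ((d : ℝ) + 1)) := by ring
    _ ≤ (1 / δ) ^ d * δ ^ (-(1 / 4) : ℝ) * δ ^ ((d : ℝ) + 1 / 2) := by gcongr
    _ = δ ^ (1 / 4 : ℝ) := by
        rw [one_div, inv_pow, ← Real.rpow_natCast, ← Real.rpow_neg hδ.le, ← Real.rpow_add hδ,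
          ← Real.rpow_add hδ]
        congr 1; ring

lemma StraightenedPatch.sum_volume_fiber_le (hp : StraightenedPatch B U F h L) {K : ℕ}
    {ρ N : ℝ} (hρ : 0 < ρ) (hρ1 : ρ ≤ 1) {P : Finset ((Fin d → ℝ) × (Fin d → ℝ))}
    (q : (Fin d → ℝ) × (Fin d → ℝ)) (hPU : ∀ p ∈ P, p.1 ∈ U ∧ dist p q ≤ ρ)
    (hs : SeparatedBy (ρ ^ 2) P) (hc : StickyCount P (ρ ^ 2) N)
    {Y : ((Fin d → ℝ) × (Fin d → ℝ)) → Set (Fin (d + 1) → ℝ)}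
    (hY : ∀ p ∈ P, Y p ⊆ {y ∈ B | dist (F y p.1) p.2 ≤ K * ρ ^ 2}) :
    ∑ p ∈ P, volume (Y p) ≤
      ENNReal.ofReal (10 ^ d * L ^ (d + 1) * (2 * K) ^ d * 2 * N * ρ ^ d) := by
  have hcard := hc.card_le_of_diam (σ := ρ ^ 2) (r := 2 * ρ) (by positivity)
    ⟨le_rfl, pow_le_one₀ hρ.le hρ1⟩ subset_rfl hs (by nlinarith) fun p hpP p' hpP' => by
      have h1 := dist_triangle_right p p' q
      have h2 : dist p.1 p'.1 ≤ dist p p' := le_max_left _ _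
      linarith [(hPU p hpP).2, (hPU p' hpP').2]
  calc ∑ p ∈ P, volume (Y p)
      ≤ ∑ p ∈ P, ENNReal.ofReal (L ^ (d + 1) * ((2 * (K * ρ ^ 2)) ^ d * 2)) :=
        Finset.sum_le_sum fun p hpP => (measure_mono (hY p hpP)).trans
          (hp.volume_tube_le (hPU p hpP).1 _ (by positivity))
    _ = ENNReal.ofReal (P.card * (L ^ (d + 1) * ((2 * (K * ρ ^ 2)) ^ d * 2))) := by
        rw [Finset.sum_const, nsmul_eq_mul, ← ENNReal.ofReal_natCast,
          ← ENNReal.ofReal_mul (by positivity)]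
    _ ≤ ENNReal.ofReal ((5 * (2 * ρ / ρ ^ 2)) ^ d * N *
          (L ^ (d + 1) * ((2 * (K * ρ ^ 2)) ^ d * 2))) := by gcongr
    _ = _ := by
        congr 1
        have : 5 * (2 * ρ / ρ ^ 2) = 10 * ρ⁻¹ := by field_simp; norm_num
        rw [this]
        have h2 : (ρ⁻¹) ^ d * ρ ^ d = 1 := by rw [← mul_pow, inv_mul_cancel₀ hρ.ne', one_pow]
        calc _ = (ρ⁻¹ ^ d * ρ ^ d) * (10 ^ d * L ^ (d + 1) * (2 * K) ^ d * 2 * N * ρ ^ d) := by ring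
          _ = _ := by rw [h2, one_mul]

end

section

variable {d : ℕ} {B : Set (Fin (d + 1) → ℝ)} {U : Set (Fin d → ℝ)}
  {F : (Fin (d + 1) → ℝ) → (Fin d → ℝ) → Fin d → ℝ}
  {h : (Fin (d + 1) → ℝ) → (Fin d → ℝ) → ℝ} {L : ℕ}

lemma ENNReal.ofReal_half_le_of_le_add {a b : ℝ} {A : ENNReal} (hb : 0 ≤ b) (hab : 2 * b ≤ a)
    (h : ENNReal.ofReal a ≤ A + ENNReal.ofReal b) : ENNReal.ofReal (a / 2) ≤ A := by
  refine le_trans ?_ (tsub_le_iff_right.2 h)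
  rw [← ENNReal.ofReal_sub _ hb]
  exact ENNReal.ofReal_le_ofReal (by linarith)

/-- Points in the same grid cell as a point of a thin tube lie in the corresponding thick tube. -/
lemma StraightenedPatch.dist_le_of_gridCell_eq (hp : StraightenedPatch B U F h L) {K : ℕ}
    (hK : 2 * L + 2 ≤ K) {ρ : ℝ} (hρ : 0 < ρ) (hKρ : K * ρ ≤ 1) {p q : (Fin d → ℝ) × (Fin d → ℝ)}
    (hpU : p.1 ∈ U) (hqU : q.1 ∈ U) (hpq : dist p q ≤ ρ) {y y' : Fin (d + 1) → ℝ} (hy : y ∈ B)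
    (hy' : y' ∈ B) (hyp : dist (F y' p.1) p.2 ≤ K * ρ ^ 2)
    (hyy' : gridCell ρ y' = gridCell ρ y) : dist (F y q.1) q.2 ≤ K * ρ := by
  have h0 := _root_.dist_le_of_gridCell_eq hρ hyy'
  have h1 := hp.lip y hy y' hy' q.1 hqU p.1 hpU
  have h2 : dist p.1 q.1 ≤ dist p q := le_max_left _ _
  have h3 : dist p.2 q.2 ≤ dist p q := le_max_right _ _
  have h4 := dist_triangle4 (F y q.1) (F y' p.1) p.2 q.2
  have h5 : (K : ℝ) * ρ ^ 2 ≤ ρ := by nlinarith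
  have h6 : (2 * L + 2 : ℝ) ≤ K := by exact_mod_cast hK
  have h7 : L * (dist y y' + dist q.1 p.1) ≤ L * (ρ + ρ) := by
    rw [dist_comm y, dist_comm q.1]
    gcongr
    exact h2.trans hpq
  nlinarith

lemma StraightenedPatch.volume_union_fibers (hp : StraightenedPatch B U F h L) {K : ℕ}
    (hK : 2 * L + 2 ≤ K) {ρ N α β : ℝ} (hρ : 0 < ρ) (hρ1 : ρ ≤ 1) (hKρ : K * ρ ≤ 1) (hN : 0 < N)
    (hα : 2 * (L ^ (d + 1) * ((2 * K) ^ d * 2)) * ρ ^ (2 * α) ≤ ρ ^ α)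
    {Q : Finset ((Fin d → ℝ) × (Fin d → ℝ))}
    {P : (Fin d → ℝ) × (Fin d → ℝ) → Finset ((Fin d → ℝ) × (Fin d → ℝ))}
    {Y : ((Fin d → ℝ) × (Fin d → ℝ)) → Set (Fin (d + 1) → ℝ)} {E : Set (Fin (d + 1) → ℝ)}
    (hQU : ∀ q ∈ Q, q.1 ∈ U)
    (hPU : ∀ q ∈ Q, ∀ p ∈ P q, p.1 ∈ U ∧ dist p q ≤ ρ)
    (hs : ∀ q ∈ Q, SeparatedBy (ρ ^ 2) (P q)) (hc : ∀ q ∈ Q, StickyCount (P q) (ρ ^ 2) N)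
    (hY : ∀ q ∈ Q, ∀ p ∈ P q, Y p ⊆ {y ∈ B | dist (F y p.1) p.2 ≤ K * ρ ^ 2})
    (hYE : ∀ q ∈ Q, ∀ p ∈ P q, Y p ⊆ E)
    (hfull : ∀ q ∈ Q, ENNReal.ofReal (ρ ^ α * ρ ^ d) ≤ volume (⋃ p ∈ P q, Y p))
    (hsum : ENNReal.ofReal β ≤ ∑ q ∈ Q, ∑ p ∈ P q, volume (Y p)) :
    ∃ Z : ((Fin d → ℝ) × (Fin d → ℝ)) → Set (Fin (d + 1) → ℝ),
      (∀ q ∈ Q, MeasurableSet (Z q) ∧ Z q ⊆ {y ∈ B | dist (F y q.1) q.2 ≤ K * ρ}) ∧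
      ENNReal.ofReal (ρ ^ α / 2 * β) ≤
        ENNReal.ofReal (10 ^ d * L ^ (d + 1) * (2 * K) ^ d * 2 * N) * ∑ q ∈ Q, volume (Z q) ∧
      ENNReal.ofReal (ρ ^ (2 * α)) * volume (⋃ q ∈ Q, Z q) ≤ volume E := by
  set θ := ENNReal.ofReal (ρ ^ (2 * α)) with hθ
  let c := gridCell (k := d + 1) ρ
  have hcm : Measurable c := measurable_gridCell ρ
  let Z : ((Fin d → ℝ) × (Fin d → ℝ)) → Set (Fin (d + 1) → ℝ) := fun q =>
    {y ∈ B | θ * volume (c ⁻¹' {c y} ∩ B) ≤ volume (c ⁻¹' {c y} ∩ E) ∧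
      ∃ y' ∈ ⋃ p ∈ P q, Y p, c y' = c y}
  have hcell : ∀ q ∈ Q, {y ∈ B | ∃ y' ∈ ⋃ p ∈ P q, Y p, c y' = c y} ⊆
      {y ∈ B | dist (F y q.1) q.2 ≤ K * ρ} := by
    rintro q hq y ⟨hy, y', hy', hyy'⟩
    obtain ⟨p, hpP, hy'⟩ := mem_iUnion₂.1 hy'
    obtain ⟨h1, h2⟩ := hY q hq p hpP hy'
    exact ⟨hy, hp.dist_le_of_gridCell_eq hK hρ hKρ (hPU q hq p hpP).1 (hQU q hq)
      (hPU q hq p hpP).2 hy h1 h2 hyy'⟩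
  refine ⟨Z, fun q hq => ⟨?_, ?_⟩, ?_, ?_⟩
  · have : Z q = B ∩ c ⁻¹' {z | θ * volume (c ⁻¹' {z} ∩ B) ≤ volume (c ⁻¹' {z} ∩ E) ∧
        ∃ y' ∈ ⋃ p ∈ P q, Y p, c y' = z} := rfl
    rw [this]
    exact hp.measurableSet.inter (hcm (to_countable _).measurableSet)
  · exact fun y hy => hcell q hq ⟨hy.1, hy.2.2⟩
  · have hZ : ∀ q ∈ Q, ENNReal.ofReal (ρ ^ α * ρ ^ d / 2) ≤ volume (Z q) := by
      intro q hq
      have h1 := measure_le_add_of_cells volume hcm (iUnion₂_subset (hYE q hq))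
        (iUnion₂_subset fun p hpP => (hY q hq p hpP).trans fun y hy => hy.1) θ
      have h2 := (measure_mono (hcell q hq)).trans
        (hp.volume_tube_le (hQU q hq) q.2 (r := K * ρ) (by positivity))
      refine ENNReal.ofReal_half_le_of_le_add
        (b := ρ ^ (2 * α) * (L ^ (d + 1) * ((2 * (K * ρ)) ^ d * 2))) (by positivity) ?_ ?_
      · calc _ = (2 * (L ^ (d + 1) * ((2 * K) ^ d * 2)) * ρ ^ (2 * α)) * ρ ^ d := by ring
          _ ≤ _ := by gcongr
      · refine (hfull q hq).trans (h1.trans ?_)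
        rw [ENNReal.ofReal_mul (by positivity)]
        exact add_le_add le_rfl (mul_le_mul_right h2 _)
    rw [ENNReal.ofReal_mul (by positivity)]
    refine (mul_le_mul_right hsum _).trans ?_
    rw [Finset.mul_sum, Finset.mul_sum]
    refine Finset.sum_le_sum fun q hq => ?_
    refine (mul_le_mul_right (hp.sum_volume_fiber_le hρ hρ1 q (hPU q hq) (hs q hq) (hc q hq)
      (hY q hq)) _).trans ?_
    refine le_trans (le_of_eq ?_) (mul_le_mul_right (hZ q hq) _)
    rw [← ENNReal.ofReal_mul (by positivity), ← ENNReal.ofReal_mul (by positivity)]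
    congr 1
    ring
  · refine le_trans (mul_le_mul_right (measure_mono ?_) θ) (mul_measure_denseCells_le volume hcm B E θ)
    exact iUnion₂_subset fun q _ y hy => ⟨hy.1, hy.2.1⟩

end

section

variable {d : ℕ} {B : Set (Fin (d + 1) → ℝ)} {U : Set (Fin d → ℝ)}
  {F : (Fin (d + 1) → ℝ) → (Fin d → ℝ) → Fin d → ℝ}
  {h : (Fin (d + 1) → ℝ) → (Fin d → ℝ) → ℝ} {L : ℕ}

/-- A set of separated parameters may be grouped into fibers over a coarser separated set,
discarding the fibers that contribute little. -/
lemma StraightenedPatch.exists_fibers (hp : StraightenedPatch B U F h L) {ρ N κ β : ℝ}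
    (hρ : 0 < ρ) (hρ1 : ρ ≤ 1) (hκ : 0 ≤ κ) (w : (Fin d → ℝ) × (Fin d → ℝ) → ENNReal)
    {P : Finset ((Fin d → ℝ) × (Fin d → ℝ))} (hPU : ∀ p ∈ P, p.1 ∈ U)
    (hc : StickyCount P (ρ ^ 2) N) (hβ : 2 * (5 ^ d * N * κ) ≤ β)
    (hsum : ENNReal.ofReal β ≤ ∑ p ∈ P, w p) :
    ∃ Q ⊆ P, ∃ P' : (Fin d → ℝ) × (Fin d → ℝ) → Finset ((Fin d → ℝ) × (Fin d → ℝ)),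
      SeparatedBy ρ Q ∧ (∀ q ∈ Q, P' q ⊆ P) ∧ (∀ q ∈ Q, ∀ p ∈ P' q, dist p q ≤ ρ) ∧
      (∀ q ∈ Q, ENNReal.ofReal (κ * ρ ^ d) ≤ ∑ p ∈ P' q, w p) ∧
      ENNReal.ofReal (β / 2) ≤ ∑ q ∈ Q, ∑ p ∈ P' q, w p := by
  classical
  obtain ⟨Q, hQP, hQs, hQ⟩ := exists_maximal_sep P hρ
  choose! f hfQ hf using hQ
  let P' := fun q => P.filter fun p => f p = q
  have hN : 0 ≤ N := by
    simpa using hc (ρ ^ 2) ⟨le_rfl, pow_le_one₀ hρ.le hρ1⟩ ∅ (by simp) (by simp [SeparatedBy]) (by simp)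
  have hcard := hc.card_le_of_diam (σ := ρ) (r := 1) (by positivity) ⟨by nlinarith, hρ1⟩ hQP hQs hρ1
    fun q hq q' hq' => hp.dist_param_le _ (hPU q (hQP hq)) _ (hPU q' (hQP hq'))
  let heavy := fun q => ENNReal.ofReal (κ * ρ ^ d) ≤ ∑ p ∈ P' q, w p
  refine ⟨Q.filter heavy, (Finset.filter_subset _ _).trans hQP, P',
    hQs.mono (Finset.filter_subset _ _), fun q _ => Finset.filter_subset _ _, ?_, ?_, ?_⟩
  · intro q _ p hpP
    obtain ⟨hp', rfl⟩ := Finset.mem_filter.1 hpP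
    exact (hf p hp').le
  · exact fun q hq => (Finset.mem_filter.1 hq).2
  · refine ENNReal.ofReal_half_le_of_le_add (b := 5 ^ d * N * κ) (by positivity) hβ ?_
    rw [← Finset.sum_fiberwise_of_maps_to hfQ w,
      ← Finset.sum_filter_add_sum_filter_not Q heavy] at hsum
    refine hsum.trans (add_le_add le_rfl ?_)
    calc _ ≤ ∑ q ∈ Q.filter (fun q => ¬ heavy q), ENNReal.ofReal (κ * ρ ^ d) :=
          Finset.sum_le_sum fun q hq => (not_le.1 (Finset.mem_filter.1 hq).2).le
      _ ≤ ∑ q ∈ Q, ENNReal.ofReal (κ * ρ ^ d) :=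
          Finset.sum_le_sum_of_subset (Finset.filter_subset _ _)
      _ = ENNReal.ofReal (Q.card * (κ * ρ ^ d)) := by
          rw [Finset.sum_const, nsmul_eq_mul, ← ENNReal.ofReal_natCast,
            ← ENNReal.ofReal_mul (by positivity)]
      _ ≤ ENNReal.ofReal ((5 * (1 / ρ)) ^ d * N * (κ * ρ ^ d)) := by gcongr
      _ = _ := by
          congr 1
          have h2 : (ρ⁻¹) ^ d * ρ ^ d = 1 := by rw [← mul_pow, inv_mul_cancel₀ hρ.ne', one_pow]
          calc _ = (ρ⁻¹ ^ d * ρ ^ d) * (5 ^ d * N * κ) := by ring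
            _ = _ := by rw [h2, one_mul]

lemma tendsto_sqrt_nhdsGT_zero : Filter.Tendsto Real.sqrt (𝓝[>] 0) (𝓝[>] 0) := by
  refine tendsto_nhdsWithin_iff.2 ⟨?_, ?_⟩
  · simpa using (Real.continuous_sqrt.tendsto 0).mono_left nhdsWithin_le_nhds
  · filter_upwards [self_mem_nhdsWithin] with ρ hρ
    exact Real.sqrt_pos.2 hρ

/-- The exponent of the sticky Kakeya bound can essentially be halved, by combining the bound at
the scale `√δ` with the bound inside tubes of radius `√δ`. -/
lemma StraightenedPatch.patchKakeya_half (hp : StraightenedPatch B U F h L)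
    (hS : StraightStickyKakeya d) {K : ℕ} (hK : 2 * L + 2 ≤ K) {ε ε' : ℝ} (hε' : 0 < ε')
    (hG : PatchKakeya B U F K ε) : PatchKakeya B U F K (ε / 2 + ε') := by
  obtain ⟨η₁, hη₁, H₁⟩ := hG
  obtain ⟨α, hα, hαε, hαη⟩ : ∃ α : ℝ, 0 < α ∧ α ≤ ε' ∧ α ≤ η₁ / 4 :=
    ⟨min ε' (η₁ / 4), by positivity, min_le_left _ _, min_le_right _ _⟩
  obtain ⟨η₂, hη₂, H₂⟩ := hp.volume_fiber hS K hα
  obtain ⟨η, hη, hηη₁, hηη₂⟩ : ∃ η : ℝ, 0 < η ∧ η ≤ η₁ / 16 ∧ η ≤ η₂ / 16 :=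
    ⟨min (η₁ / 16) (η₂ / 16), by positivity, min_le_left _ _, min_le_right _ _⟩
  let C₁ : ℝ := 10 ^ d * L ^ (d + 1) * (2 * K) ^ d * 2
  have hL := hp.one_le
  have hK0 : 0 < K := by omega
  have hC₁ : 0 < C₁ := by positivity
  have main : ∀ᶠ ρ : ℝ in 𝓝[>] 0, ∀ P : Finset ((Fin d → ℝ) × (Fin d → ℝ)),
    (∀ p ∈ P, p.1 ∈ U) → SeparatedBy (ρ ^ 2) P → StickyCount P (ρ ^ 2) ((ρ ^ 2) ^ (-η)) →
    ∀ Y : ((Fin d → ℝ) × (Fin d → ℝ)) → Set (Fin (d + 1) → ℝ),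
    (∀ p ∈ P, MeasurableSet (Y p) ∧ Y p ⊆ {y ∈ B | dist (F y p.1) p.2 ≤ K * ρ ^ 2}) →
    ENNReal.ofReal ((ρ ^ 2) ^ η) ≤ ∑ p ∈ P, volume (Y p) →
    ENNReal.ofReal ((ρ ^ 2) ^ (ε / 2 + ε')) ≤ volume (⋃ p ∈ P, Y p) := by
    filter_upwards [self_mem_nhdsWithin,
      mem_nhdsWithin_of_mem_nhds (Iio_mem_nhds (one_pos : (0 : ℝ) < 1)), H₁, H₂,
      eventually_mul_rpow_le K (zero_lt_one (α := ℝ)),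
      eventually_mul_rpow_le (2 * (L ^ (d + 1) * ((2 * K) ^ d * 2))) (show α < 2 * α by linarith),
      eventually_mul_rpow_le (2 * 5 ^ d) (show 2 * η < η₂ - 2 * η by linarith),
      eventually_mul_rpow_le (4 * C₁) (show α + 4 * η < η₁ by linarith)]
      with ρ hρ hρ1 H₁ H₂ hKρ hdense hlight hfin
    have hρ : 0 < ρ := hρ
    have hρ1 : ρ < 1 := hρ1
    rw [Real.rpow_zero, Real.rpow_one] at hKρ
    have hsq : ∀ s : ℝ, (ρ ^ 2) ^ s = ρ ^ (2 * s) := fun s => by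
      rw [← Real.rpow_natCast, ← Real.rpow_mul hρ.le]; norm_num
    intro P hPU hs hc Y hY hsum
    rw [hsq] at hc hsum
    have hN : 0 < ρ ^ (2 * -η) := Real.rpow_pos_of_pos hρ _
    have hle : ∀ {s t : ℝ}, t ≤ s → ρ ^ s ≤ ρ ^ t := fun hst =>
      Real.rpow_le_rpow_of_exponent_ge hρ hρ1.le hst
    have hρη₂ : 0 < ρ ^ η₂ := Real.rpow_pos_of_pos hρ _
    obtain ⟨Q, hQP, P', hQs, hP'P, hP'Q, hheavy, hQsum⟩ := hp.exists_fibers hρ hρ1.le hρη₂.le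
      (fun p => volume (Y p)) hPU hc (by
        refine le_trans (le_of_eq ?_) hlight
        have : η₂ - 2 * η = 2 * -η + η₂ := by ring
        rw [this, Real.rpow_add hρ]
        ring) hsum
    have hfull : ∀ q ∈ Q, ENNReal.ofReal (ρ ^ α * ρ ^ d) ≤ volume (⋃ p ∈ P' q, Y p) := fun q hq =>
      H₂ q (hPU q (hQP hq)) (P' q) (fun p hpP => ⟨hPU p (hP'P q hq hpP), hP'Q q hq p hpP⟩)
        (hs.mono (hP'P q hq)) (hc.mono (hP'P q hq) le_rfl (hle (by linarith))) Y
        (fun p hpP => hY p (hP'P q hq hpP)) (hheavy q hq)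
    obtain ⟨Z, hZ, hZsum, hZvol⟩ := hp.volume_union_fibers hK hρ hρ1.le hKρ hN hdense
      (E := ⋃ p ∈ P, Y p) (fun q hq => hPU q (hQP hq))
      (fun q hq p hpP => ⟨hPU p (hP'P q hq hpP), hP'Q q hq p hpP⟩)
      (fun q hq => hs.mono (hP'P q hq)) (fun q hq => hc.mono (hP'P q hq) le_rfl le_rfl)
      (fun q hq p hpP => (hY p (hP'P q hq hpP)).2)
      (fun q hq p hpP => subset_biUnion_of_mem (u := Y) (hP'P q hq hpP)) hfull hQsum
    have hpos : 0 < C₁ * ρ ^ (2 * -η) := by positivity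
    have hcoarse := H₁ Q (fun q hq => hPU q (hQP hq)) hQs
      (hc.mono hQP (by nlinarith) (hle (by linarith))) Z hZ (by
        rw [← ENNReal.mul_le_mul_iff_right (a := ENNReal.ofReal (C₁ * ρ ^ (2 * -η)))
          (ENNReal.ofReal_pos.2 hpos).ne' ENNReal.ofReal_ne_top]
        refine le_trans ?_ hZsum
        rw [← ENNReal.ofReal_mul hpos.le]
        apply ENNReal.ofReal_le_ofReal
        calc C₁ * ρ ^ (2 * -η) * ρ ^ η₁ = ρ ^ (2 * -η) * (4 * C₁ * ρ ^ η₁) / 4 := by ring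
          _ ≤ ρ ^ (2 * -η) * ρ ^ (α + 4 * η) / 4 := by gcongr
          _ = ρ ^ α * ρ ^ (2 * η) / 4 := by
              rw [← Real.rpow_add hρ, ← Real.rpow_add hρ]; congr 2; ring
          _ = _ := by ring)
    refine le_trans ?_ hZvol
    refine le_trans ?_ (mul_le_mul_right hcoarse _)
    rw [← ENNReal.ofReal_mul (by positivity), ← Real.rpow_add hρ, hsq]
    exact ENNReal.ofReal_le_ofReal (hle (by linarith))
  refine ⟨η, hη, ?_⟩
  filter_upwards [tendsto_sqrt_nhdsGT_zero.eventually main, self_mem_nhdsWithin] with δ H hδ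
  rwa [Real.sq_sqrt (le_of_lt hδ)] at H

theorem StraightenedPatch.patchKakeya (hp : StraightenedPatch B U F h L)
    (hS : StraightStickyKakeya d) {K : ℕ} (hK : 2 * L + 2 ≤ K) {ε : ℝ} (hε : 0 < ε) :
    PatchKakeya B U F K ε := by
  have key : ∀ k : ℕ, PatchKakeya B U F K ((d + 1) / 2 ^ k + ε / 2) := by
    intro k
    induction k with
    | zero => exact (hp.patchKakeya_of_large K).mono (by simp; positivity)
    | succ k ih =>
      refine (hp.patchKakeya_half hS hK (show 0 < ε / 4 by positivity) ih).mono (le_of_eq ?_)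
      rw [pow_succ]
      field_simp
      ring
  obtain ⟨k, hk⟩ := pow_unbounded_of_one_lt (2 * (d + 1) / ε) (one_lt_two (α := ℝ))
  refine (key k).mono ?_
  rw [div_lt_iff₀ hε] at hk
  have : ((d : ℝ) + 1) / 2 ^ k ≤ ε / 2 := by
    rw [div_le_iff₀ (by positivity)]
    linarith
  linarith

end

section

/-- Suppose that `f` and `h` together are local coordinates in the first variable, and that `g` is
constant along the fibers of `f` in the first variable to first order. Then `g` is locally a
Lipschitz function of `f`. -/
lemma exists_dist_le_of_fderiv_fst_eq_zero {X Y Z W : Type*} [NormedAddCommGroup X]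
    [NormedSpace ℝ X] [FiniteDimensional ℝ X] [NormedAddCommGroup Y] [NormedSpace ℝ Y]
    [FiniteDimensional ℝ Y] [NormedAddCommGroup Z] [NormedSpace ℝ Z] [FiniteDimensional ℝ Z]
    [NormedAddCommGroup W] [NormedSpace ℝ W] {f : X × Z → Y} {h : X × Z → ℝ} {g : X × Z → W}
    {q₁ : X × Z} (hf : ContDiffAt ℝ 1 f q₁) (hh : ContDiffAt ℝ 1 h q₁) (hg : ContDiffAt ℝ 1 g q₁)
    (hrank : Module.finrank ℝ X = Module.finrank ℝ Y + 1)
    (hinj : ∀ v, fderiv ℝ f q₁ (v, 0) = 0 → fderiv ℝ h q₁ (v, 0) = 0 → v = 0)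
    (hfg : ∀ᶠ q in 𝓝 q₁, ∀ v, fderiv ℝ f q (v, 0) = 0 → fderiv ℝ g q (v, 0) = 0) :
    ∃ C : ℝ, ∃ V ∈ 𝓝 q₁, ∀ y y' ξ, (y, ξ) ∈ V → (y', ξ) ∈ V →
      dist y y' ≤ C * max (dist (f (y, ξ)) (f (y', ξ))) (dist (h (y, ξ)) (h (y', ξ))) ∧
      dist (g (y, ξ)) (g (y', ξ)) ≤ C * dist (f (y, ξ)) (f (y', ξ)) := by
  let Θ : X × Z → (Y × ℝ) × Z := fun q => ((f q, h q), q.2)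
  have hΘ : ContDiffAt ℝ 1 Θ q₁ := (hf.prodMk hh).prodMk contDiffAt_snd
  have hΘ' : ∀ q, DifferentiableAt ℝ f q → DifferentiableAt ℝ h q → HasFDerivAt Θ
      (((fderiv ℝ f q).prod (fderiv ℝ h q)).prod (ContinuousLinearMap.snd ℝ X Z)) q :=
    fun q h1 h2 => (h1.hasFDerivAt.prodMk h2.hasFDerivAt).prodMk hasFDerivAt_snd
  have hA := hΘ' q₁ (hf.differentiableAt one_ne_zero) (hh.differentiableAt one_ne_zero)
  set A := ((fderiv ℝ f q₁).prod (fderiv ℝ h q₁)).prod (ContinuousLinearMap.snd ℝ X Z)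
  have hAinj : Function.Injective A := by
    refine (injective_iff_map_eq_zero A).2 ?_
    rintro ⟨v, z⟩ hv
    have h1 : fderiv ℝ f q₁ (v, z) = 0 := congrArg (fun p => p.1.1) hv
    have h2 : fderiv ℝ h q₁ (v, z) = 0 := congrArg (fun p => p.1.2) hv
    have h3 : z = 0 := congrArg Prod.snd hv
    subst h3
    rw [hinj v h1 h2]
    rfl
  let e : (X × Z) ≃L[ℝ] ((Y × ℝ) × Z) := (LinearEquiv.ofInjectiveOfFinrankEq (A : (X × Z) →ₗ[ℝ] _)
    hAinj (by simp [hrank])).toContinuousLinearEquiv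
  have he : HasFDerivAt Θ (e : (X × Z) →L[ℝ] ((Y × ℝ) × Z)) q₁ := by
    convert hA using 1
    exact ContinuousLinearMap.ext fun _ => rfl
  let s := hΘ.localInverse he one_ne_zero
  have hs : ContDiffAt ℝ 1 s (Θ q₁) := hΘ.to_localInverse he one_ne_zero
  have hsq : s (Θ q₁) = q₁ := hΘ.localInverse_apply_image he one_ne_zero
  have hstrict := hΘ.hasStrictFDerivAt' he one_ne_zero
  have hleft : ∀ᶠ q in 𝓝 q₁, s (Θ q) = q := hstrict.eventually_left_inverse
  have hright : ∀ᶠ p in 𝓝 (Θ q₁), Θ (s p) = p := hstrict.eventually_right_inverse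
  have hk : ContDiffAt ℝ 1 (g ∘ s) (Θ q₁) := ContDiffAt.comp _ (by rwa [hsq]) hs
  obtain ⟨K₁, t₁, ht₁, hK₁⟩ := hs.exists_lipschitzOnWith
  obtain ⟨K₂, t₂, ht₂, hK₂⟩ := hk.exists_lipschitzOnWith
  have hsc : Filter.Tendsto s (𝓝 (Θ q₁)) (𝓝 q₁) := by
    simpa [hsq] using hs.continuousAt.tendsto
  have hdf : ∀ᶠ q in 𝓝 q₁, DifferentiableAt ℝ f q :=
    (hf.eventually (by simp)).mono fun q hq => hq.differentiableAt one_ne_zero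
  have hdh : ∀ᶠ q in 𝓝 q₁, DifferentiableAt ℝ h q :=
    (hh.eventually (by simp)).mono fun q hq => hq.differentiableAt one_ne_zero
  have hdg : ∀ᶠ q in 𝓝 q₁, DifferentiableAt ℝ g q :=
    (hg.eventually (by simp)).mono fun q hq => hq.differentiableAt one_ne_zero
  have hds : ∀ᶠ p in 𝓝 (Θ q₁), DifferentiableAt ℝ s p :=
    (hs.eventually (by simp)).mono fun q hq => hq.differentiableAt one_ne_zero
  have hkz : ∀ᶠ p in 𝓝 (Θ q₁), HasFDerivAt (g ∘ s) (fderiv ℝ (g ∘ s) p) p ∧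
      fderiv ℝ (g ∘ s) p ((0, 1), 0) = 0 := by
    filter_upwards [hright.eventually_nhds, hds, hsc.eventually hdf, hsc.eventually hdh,
      hsc.eventually hdg, hsc.eventually hfg] with p h1 h2 h3 h4 h5 h6
    have h7 : HasFDerivAt (g ∘ s) ((fderiv ℝ g (s p)).comp (fderiv ℝ s p)) p :=
      h5.hasFDerivAt.comp p h2.hasFDerivAt
    refine ⟨h7.differentiableAt.hasFDerivAt, ?_⟩
    rw [h7.fderiv, ContinuousLinearMap.comp_apply]
    have h8 := (hΘ' (s p) h3 h4).comp p h2.hasFDerivAt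
    have h9 : HasFDerivAt (Θ ∘ s) (ContinuousLinearMap.id ℝ _) p :=
      (hasFDerivAt_id p).congr_of_eventuallyEq h1
    have h10 := DFunLike.congr_fun (h8.unique h9) ((0, 1), 0)
    rw [ContinuousLinearMap.comp_apply] at h10
    generalize fderiv ℝ s p ((0, 1), 0) = w at h10 ⊢
    obtain ⟨v, z⟩ := w
    have h11 : z = 0 := congrArg Prod.snd h10
    subst h11
    exact h6 v (congrArg (fun p => p.1.1) h10)
  obtain ⟨r, hr, hball⟩ := Metric.mem_nhds_iff.1 (Filter.inter_mem (Filter.inter_mem ht₁ ht₂) hkz)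
  refine ⟨max (K₁ : ℝ) K₂, {q | s (Θ q) = q ∧ Θ q ∈ ball (Θ q₁) r},
    hleft.and (hΘ.continuousAt.eventually (ball_mem_nhds _ hr)), ?_⟩
  rintro y y' ξ ⟨hy1, hy2⟩ ⟨hy1', hy2'⟩
  constructor
  · have h1 := hK₁.dist_le_mul _ (hball hy2).1.1 _ (hball hy2').1.1
    rw [hy1, hy1'] at h1
    have h2 : dist (Θ (y, ξ)) (Θ (y', ξ)) =
        max (dist (f (y, ξ)) (f (y', ξ))) (dist (h (y, ξ)) (h (y', ξ))) := by
      simp [Θ, Prod.dist_eq]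
    rw [h2] at h1
    calc dist y y' ≤ dist (y, ξ) (y', ξ) := le_max_left _ _
      _ ≤ _ := h1
      _ ≤ _ := by gcongr; exact le_max_left _ _
  · have hmem : ∀ a b c, ((a, b), c) ∈ ball (Θ q₁) r ↔
        (a ∈ ball (f q₁) r ∧ b ∈ ball (h q₁) r) ∧ c ∈ ball q₁.2 r := by
      intro a b c
      simp [Θ, Prod.dist_eq, mem_ball]
    obtain ⟨⟨ha, hb⟩, hc⟩ := (hmem _ _ _).1 hy2
    obtain ⟨⟨ha', hb'⟩, -⟩ := (hmem _ _ _).1 hy2'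
    have hconst : (g ∘ s) ((f (y, ξ), h (y, ξ)), ξ) = (g ∘ s) ((f (y, ξ), h (y', ξ)), ξ) := by
      have hder : ∀ τ ∈ ball (h q₁) r,
          HasDerivAt (fun τ => (g ∘ s) ((f (y, ξ), τ), ξ)) 0 τ := by
        intro τ hτ
        obtain ⟨hd, h0⟩ := (hball ((hmem _ _ _).2 ⟨⟨ha, hτ⟩, hc⟩)).2
        have h1 : HasDerivAt (fun τ : ℝ => ((f (y, ξ), τ), ξ)) ((0, 1), 0) τ :=
          ((hasDerivAt_const τ _).prodMk (hasDerivAt_id τ)).prodMk (hasDerivAt_const τ _)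
        have h2 := hd.comp_hasDerivAt τ h1
        rwa [h0] at h2
      exact isOpen_ball.is_const_of_deriv_eq_zero (convex_ball _ _).isPreconnected
        (fun τ hτ => (hder τ hτ).differentiableAt.differentiableWithinAt)
        (fun τ hτ => (hder τ hτ).deriv) hb hb'
    have h1 := hK₂.dist_le_mul _ (hball ((hmem _ _ _).2 ⟨⟨ha, hb'⟩, hc⟩)).1.2 _ (hball hy2').1.2
    rw [← hconst] at h1
    have e1 : (g ∘ s) ((f (y, ξ), h (y, ξ)), ξ) = g (y, ξ) := congrArg g hy1
    have e2 : (g ∘ s) (Θ (y', ξ)) = g (y', ξ) := congrArg g hy1'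
    have h2 : dist ((f (y, ξ), h (y', ξ)), ξ) (Θ (y', ξ)) = dist (f (y, ξ)) (f (y', ξ)) := by
      simp [Θ, Prod.dist_eq]
    rw [e1, e2, h2] at h1
    refine h1.trans ?_
    gcongr
    exact le_max_right _ _

end

section

open scoped ContDiff in
/-- If the `x`-derivative of `H = ∂_ξ f` along the kernel direction `G` of `∂_x f` is injective and
its own derivative along `G` is proportional to it, then the fibers of `f` can be straightened near
any given point. -/
lemma exists_straightenedPatch {d : ℕ} (hd : 0 < d)
    {f : (Fin (d + 1) → ℝ) × (Fin d → ℝ) → (Fin d → ℝ)}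
    {G : (Fin (d + 1) → ℝ) × (Fin d → ℝ) → (Fin (d + 1) → ℝ)}
    {H GH : (Fin (d + 1) → ℝ) × (Fin d → ℝ) → ((Fin d → ℝ) →L[ℝ] (Fin d → ℝ))}
    {q₁ : (Fin (d + 1) → ℝ) × (Fin d → ℝ)}
    (hf : ContDiffAt ℝ ∞ f q₁) (hG : ContDiffAt ℝ ∞ G q₁)
    (hH : H = fun q => (fderiv ℝ f q).comp (ContinuousLinearMap.inr ℝ _ _))
    (hGH : GH = fun q => fderiv ℝ H q (G q, 0))
    (hker : ∀ᶠ q in 𝓝 q₁, ∀ v, fderiv ℝ f q (v, 0) = 0 → ∃ c : ℝ, v = c • G q)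
    (hinj : Function.Injective (GH q₁))
    (hB : ∃ lam : (Fin (d + 1) → ℝ) × (Fin d → ℝ) → ℝ,
      ∀ᶠ q in 𝓝 q₁, fderiv ℝ GH q (G q, 0) = lam q • GH q) :
    ∃ r > 0, ∃ h L, StraightenedPatch (ball q₁.1 r) (ball q₁.2 r) (fun y ξ => f (y, ξ)) h L := by
  obtain ⟨lam, hB⟩ := hB
  have hHs : ContDiffAt ℝ ∞ H q₁ := by
    rw [hH]
    exact (hf.fderiv_right (m := ∞) (by simp)).clm_comp contDiffAt_const
  have hGHs : ContDiffAt ℝ ∞ GH q₁ := by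
    rw [hGH]
    exact (hHs.fderiv_right (m := ∞) (by simp)).clm_apply (hG.prodMk contDiffAt_const)
  have hGH0 : GH q₁ ≠ 0 := by
    intro h0
    have h1 := @hinj (Pi.single ⟨0, hd⟩ 1) 0 (by simp [h0])
    simpa using congrFun h1 ⟨0, hd⟩
  obtain ⟨l, hl⟩ := SeparatingDual.exists_ne_zero (R := ℝ) hGH0
  set h : (Fin (d + 1) → ℝ) × (Fin d → ℝ) → ℝ := fun q => l (H q) with hh
  set c : (Fin (d + 1) → ℝ) × (Fin d → ℝ) → ℝ := fun q => l (GH q) with hc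
  set R := fun q => (c q)⁻¹ • GH q with hR
  set J := fun q => H q - h q • R q with hJ
  have hhs : ContDiffAt ℝ ∞ h q₁ := l.contDiff.contDiffAt.comp q₁ hHs
  have hcs : ContDiffAt ℝ ∞ c q₁ := l.contDiff.contDiffAt.comp q₁ hGHs
  have hRs : ContDiffAt ℝ ∞ R q₁ := (hcs.inv hl).smul hGHs
  have hJs : ContDiffAt ℝ ∞ J q₁ := hHs.sub (hhs.smul hRs)
  have hdf {W : Type} [NormedAddCommGroup W] [NormedSpace ℝ W]
      {k : (Fin (d + 1) → ℝ) × (Fin d → ℝ) → W} (hk : ContDiffAt ℝ ∞ k q₁) :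
      ∀ᶠ q in 𝓝 q₁, DifferentiableAt ℝ k q :=
    ((hk.of_le (show (1 : WithTop ℕ∞) ≤ ∞ by simp)).eventually (by simp)).mono
      fun q hq => hq.differentiableAt one_ne_zero
  have hc0 : ∀ᶠ q in 𝓝 q₁, c q ≠ 0 := hcs.continuousAt.eventually_ne hl
  have hRJ : ∀ᶠ q in 𝓝 q₁, ∀ v, fderiv ℝ f q (v, 0) = 0 →
      fderiv ℝ (fun q => (R q, J q)) q (v, 0) = 0 := by
    filter_upwards [hker, hB, hc0.eventually_nhds, hdf hHs, hdf hGHs, hdf hhs, hdf hcs, hdf hRs,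
      hdf hJs] with q h1 h2 h3 h4 h5 h6 h7 h8 h9 v hv
    obtain ⟨a, rfl⟩ := h1 v hv
    have hc' : fderiv ℝ c q (G q, 0) = lam q * c q := by
      have := (l.hasFDerivAt.comp q h5.hasFDerivAt).fderiv
      rw [show c = l ∘ GH from rfl, this, ContinuousLinearMap.comp_apply, h2]
      simp
    have hh' : fderiv ℝ h q (G q, 0) = c q := by
      have := (l.hasFDerivAt.comp q h4.hasFDerivAt).fderiv
      rw [show h = l ∘ H from rfl, this, ContinuousLinearMap.comp_apply, hc, hGH]
    have hcR : c q • R q = GH q := smul_inv_smul₀ h3.self_of_nhds _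
    have hR' : fderiv ℝ R q (G q, 0) = 0 := by
      have e1 : GH =ᶠ[𝓝 q] fun q => c q • R q :=
        h3.mono fun q hq => (smul_inv_smul₀ hq _).symm
      have e2 := (h7.hasFDerivAt.smul h8.hasFDerivAt).congr_of_eventuallyEq e1
      have e3 := DFunLike.congr_fun e2.fderiv (G q, 0)
      simp only [add_apply, smul_apply,
        ContinuousLinearMap.smulRight_apply, h2, hc', mul_smul, hcR] at e3
      have e4 : c q • fderiv ℝ R q (G q, 0) = 0 := by simpa using e3
      exact (smul_eq_zero.1 e4).resolve_left h3.self_of_nhds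
    have hJ' : fderiv ℝ J q (G q, 0) = 0 := by
      have e2 := h4.hasFDerivAt.sub (h6.hasFDerivAt.smul h8.hasFDerivAt)
      have e3 := DFunLike.congr_fun (HasFDerivAt.fderiv (f := J) e2) (G q, 0)
      rw [e3]
      simp only [sub_apply, add_apply, smul_apply,
        ContinuousLinearMap.smulRight_apply, hR', hh', hcR]
      rw [hGH]
      simp
    rw [show ((a • G q, 0) : (Fin (d + 1) → ℝ) × (Fin d → ℝ)) = a • (G q, 0) by simp, map_smul,
      (h8.hasFDerivAt.prodMk h9.hasFDerivAt).fderiv, ContinuousLinearMap.prod_apply, hR', hJ']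
    simp
  have hle : (1 : WithTop ℕ∞) ≤ ∞ := by simp
  obtain ⟨C, V, hV, hCV⟩ := exists_dist_le_of_fderiv_fst_eq_zero (hf.of_le hle) (hhs.of_le hle)
    ((hRs.prodMk hJs).of_le hle) (by simp) (fun v h1 h2 => by
      obtain ⟨a, rfl⟩ := hker.self_of_nhds v h1
      have := ((l.hasFDerivAt.comp q₁ (hdf hHs).self_of_nhds.hasFDerivAt)).fderiv
      rw [show h = l ∘ H from rfl, this,
        show ((a • G q₁, 0) : (Fin (d + 1) → ℝ) × (Fin d → ℝ)) = a • (G q₁, 0) by simp, map_smul,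
        ContinuousLinearMap.comp_apply] at h2
      have h3 : l (fderiv ℝ H q₁ (G q₁, 0)) = l (GH q₁) := by rw [hGH]
      rw [h3] at h2
      rw [(smul_eq_zero.1 h2).resolve_right hl, zero_smul]) hRJ
  obtain ⟨Kf, Vf, hVf, hKf⟩ := (hf.of_le hle).exists_lipschitzOnWith
  obtain ⟨Kh, Vh, hVh, hKh⟩ := (hhs.of_le hle).exists_lipschitzOnWith
  obtain ⟨KH, VH, hVH, hKH⟩ := (hHs.of_le hle).exists_lipschitzOnWith
  have hRinj : Function.Injective (R q₁) := by
    intro x y hxy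
    apply hinj
    simpa [hR, inv_eq_zero, hl, hc] using hxy
  obtain ⟨KR, hKR0, hKR⟩ := LinearMap.exists_antilipschitzWith
    (R q₁ : (Fin d → ℝ) →ₗ[ℝ] (Fin d → ℝ)) (LinearMap.ker_eq_bot_of_injective hRinj)
  have hRc : ∀ᶠ q in 𝓝 q₁, ‖R q - R q₁‖ < (2 * (KR : ℝ))⁻¹ := by
    have := Metric.continuousAt_iff'.1 hRs.continuousAt (2 * (KR : ℝ))⁻¹ (by positivity)
    simpa [dist_eq_norm] using this
  have hRb : ∀ᶠ q in 𝓝 q₁, ‖R q‖ < ‖R q₁‖ + 1 :=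
    hRs.continuousAt.norm.eventually_lt_const (lt_add_one _)
  have hHb : ∀ᶠ q in 𝓝 q₁, ‖H q‖ < ‖H q₁‖ + 1 :=
    hHs.continuousAt.norm.eventually_lt_const (lt_add_one _)
  have hhb : ∀ᶠ q in 𝓝 q₁, ‖h q‖ < ‖h q₁‖ + 1 :=
    hhs.continuousAt.norm.eventually_lt_const (lt_add_one _)
  have hho : ∀ᶠ q in 𝓝 q₁, dist (h q) (h q₁) < 1 / 2 :=
    Metric.continuousAt_iff'.1 hhs.continuousAt (1 / 2) (by positivity)
  obtain ⟨r, hr, hball⟩ := Metric.mem_nhds_iff.1 ((Filter.eventually_mem_set.2 hV).and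
    ((Filter.eventually_mem_set.2 hVf).and ((Filter.eventually_mem_set.2 hVh).and
    ((Filter.eventually_mem_set.2 hVH).and (hRc.and (hRb.and (hHb.and (hhb.and (hho.and
      (hdf hf))))))))))
  obtain ⟨L, hL⟩ := exists_nat_ge (1 + Kf + Kh + KH + |C| * (2 + ‖h q₁‖) + (‖H q₁‖ + 1) +
    (‖R q₁‖ + 1) + 2 * KR : ℝ)
  have hp1 : 0 ≤ |C| * (2 + ‖h q₁‖) := by positivity
  have hp2 := norm_nonneg (H q₁)
  have hp3 := norm_nonneg (R q₁)
  have hp4 := Kf.coe_nonneg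
  have hp5 := Kh.coe_nonneg
  have hp6 := KH.coe_nonneg
  have hp7 := KR.coe_nonneg
  have hp8 := abs_nonneg C
  have hp9 := norm_nonneg (h q₁)
  have hLC : |C| ≤ L := le_trans (by nlinarith) hL
  have hmem : ∀ y ∈ ball q₁.1 (min r (1 / 2)), ∀ ξ ∈ ball q₁.2 (min r (1 / 2)),
      (y, ξ) ∈ ball q₁ r := by
    intro y hy ξ hξ
    rw [mem_ball, Prod.dist_eq]
    exact max_lt (hy.trans_le (min_le_left _ _)) (hξ.trans_le (min_le_left _ _))
  refine ⟨min r (1 / 2), by positivity, fun y ξ => h (y, ξ), L, ?_, measurableSet_ball, ?_, ?_, ?_,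
    ?_, ?_, ?_⟩
  · exact_mod_cast (show (1 : ℝ) ≤ L by linarith)
  · intro ξ hξ ξ' hξ'
    have h1 := (mem_ball.1 hξ).trans_le (min_le_right _ _)
    have h2 := (mem_ball.1 hξ').trans_le (min_le_right _ _)
    linarith [dist_triangle_right ξ ξ' q₁.2]
  · intro y hy y' hy' ξ hξ ξ' hξ'
    refine (hKf.dist_le_mul _ (hball (hmem y hy ξ hξ)).2.1 _ (hball (hmem y' hy' ξ' hξ')).2.1).trans
      ?_
    gcongr
    · linarith
    · rw [Prod.dist_eq]
      exact max_le_add_of_nonneg dist_nonneg dist_nonneg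
  · intro y hy y' hy' ξ hξ
    have h1 := hKh.dist_le_mul _ (hball (hmem y hy ξ hξ)).2.2.1 _ (hball (hmem y' hy' ξ hξ)).2.2.1
    rw [dist_prod_same_right] at h1
    exact h1.trans (by gcongr; linarith)
  · intro y hy y' hy' ξ hξ
    have h1 := (hball (hmem y hy ξ hξ)).2.2.2.2.2.2.2.2.1
    have h2 := (hball (hmem y' hy' ξ hξ)).2.2.2.2.2.2.2.2.1
    linarith [dist_triangle_right (h (y, ξ)) (h (y', ξ)) (h q₁)]
  · intro y hy y' hy' ξ hξ
    refine (hCV y y' ξ (hball (hmem y hy ξ hξ)).1 (hball (hmem y' hy' ξ hξ)).1).1.trans ?_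
    gcongr
    exact (le_abs_self C).trans hLC
  · intro ξ₀ hξ₀ y₀ hy₀
    have hq₀ := hball (hmem y₀ hy₀ ξ₀ hξ₀)
    refine ⟨H (y₀, ξ₀), R (y₀, ξ₀), fun x => ?_, fun x => ?_, fun x => ?_, fun y hy ξ hξ => ?_⟩
    · exact ((H (y₀, ξ₀)).le_opNorm x).trans
        (by gcongr; linarith [hq₀.2.2.2.2.2.2.1])
    · exact ((R (y₀, ξ₀)).le_opNorm x).trans
        (by gcongr; linarith [hq₀.2.2.2.2.2.1])
    · have h1 : ‖x‖ ≤ KR * ‖R q₁ x‖ := by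
        simpa using hKR.le_mul_dist x 0
      have h2 : ‖R q₁ x‖ ≤ ‖R (y₀, ξ₀) x‖ + (2 * (KR : ℝ))⁻¹ * ‖x‖ := by
        have h3 : ‖(R (y₀, ξ₀) - R q₁) x‖ ≤ (2 * (KR : ℝ))⁻¹ * ‖x‖ :=
          ((R (y₀, ξ₀) - R q₁).le_opNorm x).trans (by gcongr; exact hq₀.2.2.2.2.1.le)
        have h4 : R q₁ x = R (y₀, ξ₀) x - (R (y₀, ξ₀) - R q₁) x := by simp
        rw [h4]
        exact (norm_sub_le _ _).trans (by gcongr)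
      have hKR0' : (0 : ℝ) < KR := hKR0
      have h3 : (KR : ℝ) * ((2 * (KR : ℝ))⁻¹ * ‖x‖) = ‖x‖ / 2 := by field_simp
      have h4 : ‖x‖ ≤ 2 * KR * ‖R (y₀, ξ₀) x‖ := by
        have := mul_le_mul_of_nonneg_left h2 hp7
        linarith
      exact h4.trans (mul_le_mul_of_nonneg_right (by linarith) (norm_nonneg _))
    · have hq := hball (hmem y hy ξ₀ hξ₀)
      have h1 : ‖f (y, ξ) - f (y, ξ₀) - H (y, ξ₀) (ξ - ξ₀)‖ ≤ KH * ‖ξ - ξ₀‖ * ‖ξ - ξ₀‖ := by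
        refine ((convex_ball q₁.2 (min r (1 / 2))).inter
          (convex_closedBall ξ₀ ‖ξ - ξ₀‖)).norm_image_sub_le_of_norm_hasFDerivWithin_le'
          (f := fun η => f (y, η)) (f' := fun η => H (y, η)) (fun η hη => ?_) (fun η hη => ?_)
          ⟨hξ₀, by simp⟩ ⟨hξ, by simp [dist_eq_norm]⟩
        · have h2 : HasFDerivAt (fun η => ((y, η) : (Fin (d + 1) → ℝ) × (Fin d → ℝ)))
              (ContinuousLinearMap.inr ℝ _ _) η := hasFDerivAt_prodMk_right y η
          have h3 := (hball (hmem y hy η hη.1)).2.2.2.2.2.2.2.2.2.hasFDerivAt.comp η h2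
          rw [hH]
          exact h3.hasFDerivWithinAt
        · have h2 := hKH.dist_le_mul _ (hball (hmem y hy η hη.1)).2.2.2.1 _ hq.2.2.2.1
          rw [dist_prod_same_left, dist_eq_norm] at h2
          exact h2.trans (by gcongr; exact hη.2)
      obtain ⟨-, h2⟩ := hCV y y₀ ξ₀ hq.1 hq₀.1
      set D := dist (f (y, ξ₀)) (f (y₀, ξ₀)) with hD
      have hD0 : 0 ≤ D := dist_nonneg
      have h3 : C * D ≤ |C| * D := by gcongr; exact le_abs_self C
      rw [Prod.dist_eq] at h2
      have h4 : ‖R (y, ξ₀) - R (y₀, ξ₀)‖ ≤ |C| * D := by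
        rw [← dist_eq_norm]; exact (le_max_left _ _).trans (h2.trans h3)
      have h5 : ‖J (y, ξ₀) - J (y₀, ξ₀)‖ ≤ |C| * D := by
        rw [← dist_eq_norm]; exact (le_max_right _ _).trans (h2.trans h3)
      have h6 : H (y, ξ₀) - H (y₀, ξ₀) - (h (y, ξ₀) - h (y₀, ξ₀)) • R (y₀, ξ₀) =
          J (y, ξ₀) - J (y₀, ξ₀) + h (y, ξ₀) • (R (y, ξ₀) - R (y₀, ξ₀)) := by
        simp only [hJ]
        module
      have h7 : ‖J (y, ξ₀) - J (y₀, ξ₀) + h (y, ξ₀) • (R (y, ξ₀) - R (y₀, ξ₀))‖ ≤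
          |C| * (2 + ‖h q₁‖) * D := by
        refine (norm_add_le _ _).trans ?_
        rw [norm_smul]
        have : ‖h (y, ξ₀)‖ * ‖R (y, ξ₀) - R (y₀, ξ₀)‖ ≤ (‖h q₁‖ + 1) * (|C| * D) :=
          mul_le_mul hq.2.2.2.2.2.2.2.1.le h4 (norm_nonneg _) (by positivity)
        linarith
      have h8 : f (y, ξ) - f (y, ξ₀) - H (y₀, ξ₀) (ξ - ξ₀) -
          (h (y, ξ₀) - h (y₀, ξ₀)) • R (y₀, ξ₀) (ξ - ξ₀) =
          (f (y, ξ) - f (y, ξ₀) - H (y, ξ₀) (ξ - ξ₀)) +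
          (J (y, ξ₀) - J (y₀, ξ₀) + h (y, ξ₀) • (R (y, ξ₀) - R (y₀, ξ₀))) (ξ - ξ₀) := by
        rw [← h6]
        simp only [sub_apply, smul_apply]
        abel
      have h9 := (ContinuousLinearMap.le_opNorm _ (ξ - ξ₀)).trans
        (mul_le_mul_of_nonneg_right h7 (norm_nonneg (ξ - ξ₀)))
      simp only [ContinuousLinearMap.coe_coe]
      rw [h8]
      refine (norm_add_le _ _).trans ((add_le_add h1 h9).trans ?_)
      rw [← add_mul, mul_add (L : ℝ)]
      gcongr <;> linarith

end

section

lemma fderiv_comp_prodMk_left {X Z W : Type*} [NormedAddCommGroup X] [NormedSpace ℝ X]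
    [NormedAddCommGroup Z] [NormedSpace ℝ Z] [NormedAddCommGroup W] [NormedSpace ℝ W]
    {k : X × Z → W} {q : X × Z} (hk : DifferentiableAt ℝ k q) (v : X) :
    fderiv ℝ (fun y => k (y, q.2)) q.1 v = fderiv ℝ k q (v, 0) := by
  have hk' : HasFDerivAt k (fderiv ℝ k q) (q.1, q.2) := hk.hasFDerivAt
  have h1 := HasFDerivAt.comp (f := fun y => (y, q.2)) q.1 hk' (hasFDerivAt_prodMk_left q.1 q.2)
  exact DFunLike.congr_fun h1.fderiv v

lemma fderiv_comp_prodMk_right {X Z W : Type*} [NormedAddCommGroup X] [NormedSpace ℝ X]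
    [NormedAddCommGroup Z] [NormedSpace ℝ Z] [NormedAddCommGroup W] [NormedSpace ℝ W]
    {k : X × Z → W} {q : X × Z} (hk : DifferentiableAt ℝ k q) (v : Z) :
    fderiv ℝ (fun η => k (q.1, η)) q.2 v = fderiv ℝ k q (0, v) := by
  have hk' : HasFDerivAt k (fderiv ℝ k q) (q.1, q.2) := hk.hasFDerivAt
  have h1 := hk'.comp q.2 (hasFDerivAt_prodMk_right q.1 q.2)
  exact DFunLike.congr_fun h1.fderiv v

lemma fderiv_apply_coord {X ι : Type*} [Fintype ι] [NormedAddCommGroup X] [NormedSpace ℝ X]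
    {k : X → ι → ℝ} {q : X} (hk : DifferentiableAt ℝ k q) (i : ι) (v : X) :
    fderiv ℝ (fun q => k q i) q v = fderiv ℝ k q v i :=
  DFunLike.congr_fun (hasFDerivAt_pi'.1 hk.hasFDerivAt i).fderiv v

lemma gaussMap_eq_adjugate {d : ℕ} (φ : (Fin (d + 1) → ℝ) → (Fin d → ℝ) → ℝ)
    (x : Fin (d + 1) → ℝ) (ξ : Fin d → ℝ) (i : Fin (d + 1)) :
    gaussMap (d + 1) φ x ξ i = (Matrix.of fun a b : Fin (d + 1) =>
      if h : (b : ℕ) < d then mixedHess (d + 1) φ x ξ a ⟨(b : ℕ), h⟩ else 0).adjugate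
        (Fin.last d) i := by
  set A : Matrix (Fin (d + 1)) (Fin (d + 1)) ℝ := Matrix.of fun a b : Fin (d + 1) =>
      if h : (b : ℕ) < d then mixedHess (d + 1) φ x ξ a ⟨(b : ℕ), h⟩ else 0 with hA
  have h1 : A.adjugate (Fin.last d) i = A.cramer (Pi.single i 1) (Fin.last d) := by
    rw [Matrix.cramer_eq_adjugate_mulVec, Matrix.mulVec_single_one]
    rfl
  rw [h1, Matrix.cramer_apply, gaussMap]
  congr 1
  ext a b
  rcases Fin.eq_castSucc_or_eq_last b with ⟨b, rfl⟩ | rfl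
  · simp [hA, (Fin.castSucc_lt_last b).ne]
  · simp

lemma gaussMap_vecMul_mixedHess {d : ℕ} (φ : (Fin (d + 1) → ℝ) → (Fin d → ℝ) → ℝ)
    (x : Fin (d + 1) → ℝ) (ξ : Fin d → ℝ) :
    Matrix.vecMul (gaussMap (d + 1) φ x ξ) (mixedHess (d + 1) φ x ξ) = 0 := by
  ext j
  have h1 := congrFun (congrFun (Matrix.adjugate_mul (Matrix.of fun a b : Fin (d + 1) =>
      if h : (b : ℕ) < d then mixedHess (d + 1) φ x ξ a ⟨(b : ℕ), h⟩ else 0)) (Fin.last d))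
      (Fin.castSucc (n := d) j)
  rw [Matrix.smul_apply, Matrix.one_apply_ne (Fin.castSucc_lt_last (n := d) j).ne', smul_zero,
    Matrix.mul_apply] at h1
  rw [Matrix.vecMul, dotProduct]
  simp only [gaussMap_eq_adjugate]
  simpa using h1

lemma exists_eq_smul_gaussMap {d : ℕ} {φ : (Fin (d + 1) → ℝ) → (Fin d → ℝ) → ℝ}
    {x : Fin (d + 1) → ℝ} {ξ : Fin d → ℝ} (hr : (mixedHess (d + 1) φ x ξ).rank = d)
    (hG : gaussMap (d + 1) φ x ξ ≠ 0) {v : Fin (d + 1) → ℝ}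
    (hv : Matrix.vecMul v (mixedHess (d + 1) φ x ξ) = 0) :
    ∃ c : ℝ, v = c • gaussMap (d + 1) φ x ξ := by
  set T := (mixedHess (d + 1) φ x ξ).transpose.mulVecLin
  have hT : ∀ w, T w = Matrix.vecMul w (mixedHess (d + 1) φ x ξ) := fun w => by
    simp [T]
  have h1 : Module.finrank ℝ (LinearMap.ker T) = 1 := by
    have h2 := LinearMap.finrank_range_add_finrank_ker T
    have h3 : Module.finrank ℝ (LinearMap.range T) = d :=
      (Matrix.rank_transpose _).trans hr
    rw [h3] at h2
    simp at h2
    omega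
  obtain ⟨c, hc⟩ := (finrank_eq_one_iff_of_nonzero' (⟨gaussMap (d + 1) φ x ξ, by
    rw [LinearMap.mem_ker, hT, gaussMap_vecMul_mixedHess]⟩ : LinearMap.ker T)
    (by simpa [Subtype.ext_iff] using hG)).1 h1 ⟨v, by rw [LinearMap.mem_ker, hT, hv]⟩
  exact ⟨c, (congrArg Subtype.val hc).symm⟩

open scoped ContDiff in
/-- A phase satisfying Bourgain's condition has straightened patches around each point. -/
lemma IsHormander.exists_straightenedPatch {d : ℕ} (hd : 0 < d) {M : Set (Fin (d + 1) → ℝ)}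
    {Ω : Set (Fin d → ℝ)} (hM : IsOpen M) (hΩ : IsOpen Ω)
    {φ : (Fin (d + 1) → ℝ) → (Fin d → ℝ) → ℝ} (hφ : IsHormander (d + 1) φ M Ω)
    (hB : BourgainCond (d + 1) φ M Ω) :
    ∀ x ∈ M, ∀ ξ ∈ Ω, ∃ r > 0, ∃ h L,
      StraightenedPatch (ball x r) (ball ξ r) (gradXi (d + 1) φ) h L := by
  obtain ⟨hs, hr, hdet⟩ := hφ
  obtain ⟨lam, hB⟩ := hB
  set Φ : (Fin (d + 1) → ℝ) × (Fin d → ℝ) → ℝ := fun q => φ q.1 q.2 with hΦ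
  set F : (Fin (d + 1) → ℝ) × (Fin d → ℝ) → (Fin d → ℝ) :=
    fun q => gradXi (d + 1) φ q.1 q.2 with hF
  set G : (Fin (d + 1) → ℝ) × (Fin d → ℝ) → (Fin (d + 1) → ℝ) :=
    fun q => gaussMap (d + 1) φ q.1 q.2 with hG
  set H : (Fin (d + 1) → ℝ) × (Fin d → ℝ) → ((Fin d → ℝ) →L[ℝ] (Fin d → ℝ)) :=
    fun q => (fderiv ℝ F q).comp (ContinuousLinearMap.inr ℝ _ _) with hH
  set GH : (Fin (d + 1) → ℝ) × (Fin d → ℝ) → ((Fin d → ℝ) →L[ℝ] (Fin d → ℝ)) :=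
    fun q => fderiv ℝ H q (G q, 0) with hGH
  have hdiff {W : Type} [NormedAddCommGroup W] [NormedSpace ℝ W]
      {k : (Fin (d + 1) → ℝ) × (Fin d → ℝ) → W} {q} (hk : ContDiffAt ℝ ∞ k q) :
      DifferentiableAt ℝ k q := hk.differentiableAt (by simp)
  have hO : IsOpen (M ×ˢ Ω) := hM.prod hΩ
  have hΦs : ∀ q ∈ M ×ˢ Ω, ContDiffAt ℝ ∞ Φ q := fun q hq => hs.contDiffAt (hO.mem_nhds hq)
  have hFe : ∀ q ∈ M ×ˢ Ω, ∀ j, F q j = fderiv ℝ Φ q (0, Pi.single j 1) := fun q hq j =>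
    fderiv_comp_prodMk_right (k := Φ) (hdiff (hΦs q hq)) _
  have hFs : ∀ q ∈ M ×ˢ Ω, ContDiffAt ℝ ∞ F q := fun q hq => by
    refine contDiffAt_pi.2 fun j => ?_
    refine (((hΦs q hq).fderiv_right (m := ∞) (by simp)).clm_apply
      (contDiffAt_const (c := ((0, Pi.single j 1) :
        (Fin (d + 1) → ℝ) × (Fin d → ℝ))))).congr_of_eventuallyEq ?_
    filter_upwards [hO.mem_nhds hq] with p hp using hFe p hp j
  have hHs : ∀ q ∈ M ×ˢ Ω, ContDiffAt ℝ ∞ H q := fun q hq =>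
    ((hFs q hq).fderiv_right (m := ∞) (by simp)).clm_comp contDiffAt_const
  have hmix : ∀ q ∈ M ×ˢ Ω, ∀ i j, mixedHess (d + 1) φ q.1 q.2 i j =
      fderiv ℝ F q (Pi.single i 1, 0) j := fun q hq i j => by
    rw [← fderiv_apply_coord (hdiff (hFs q hq))]
    exact fderiv_comp_prodMk_left (k := fun q => F q j)
      (differentiableAt_pi.1 (hdiff (hFs q hq)) j) _
  have hGs : ∀ q ∈ M ×ˢ Ω, ContDiffAt ℝ ∞ G q := fun q hq => by
    refine contDiffAt_pi.2 fun i => ?_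
    simp only [hG, gaussMap, Matrix.det_apply]
    refine ContDiffAt.sum fun σ _ => ContDiffAt.const_smul _ (contDiffAt_prod fun b _ => ?_)
    by_cases hb : (b : ℕ) < d
    · refine (contDiffAt_pi.1 (((hFs q hq).fderiv_right (m := ∞) (by simp)).clm_apply
        (contDiffAt_const (c := ((Pi.single (σ b) 1, 0) :
          (Fin (d + 1) → ℝ) × (Fin d → ℝ))))) ⟨b, hb⟩).congr_of_eventuallyEq ?_
      filter_upwards [hO.mem_nhds hq] with p hp
      rw [← hmix p hp]
      simp [hb]
    · simpa [hb] using contDiffAt_const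
  have hGHs : ∀ q ∈ M ×ˢ Ω, ContDiffAt ℝ ∞ GH q := fun q hq =>
    ((hHs q hq).fderiv_right (m := ∞) (by simp)).clm_apply ((hGs q hq).prodMk contDiffAt_const)
  have hcoord {k : (Fin (d + 1) → ℝ) × (Fin d → ℝ) → ((Fin d → ℝ) →L[ℝ] (Fin d → ℝ))} {q}
      (hk : DifferentiableAt ℝ k q) (i j : Fin d) :
      HasFDerivAt (fun q => k q (Pi.single j 1) i) (((ContinuousLinearMap.proj (R := ℝ)
        (φ := fun _ : Fin d => ℝ) i).comp (ContinuousLinearMap.apply ℝ (Fin d → ℝ)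
          (Pi.single j 1))).comp (fderiv ℝ k q)) q :=
    HasFDerivAt.comp (g := fun T : (Fin d → ℝ) →L[ℝ] (Fin d → ℝ) => T (Pi.single j 1) i) q
      (((ContinuousLinearMap.proj (R := ℝ) (φ := fun _ : Fin d => ℝ) i).comp
        (ContinuousLinearMap.apply ℝ (Fin d → ℝ) (Pi.single j 1))).hasFDerivAt) hk.hasFDerivAt
  have hGDe {k : (Fin (d + 1) → ℝ) × (Fin d → ℝ) → ((Fin d → ℝ) →L[ℝ] (Fin d → ℝ))}
      {e : (Fin (d + 1) → ℝ) × (Fin d → ℝ) → ℝ} {q} (hq : q ∈ M ×ˢ Ω)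
      (hk : DifferentiableAt ℝ k q) (i j : Fin d)
      (he : ∀ p ∈ M ×ˢ Ω, e p = k p (Pi.single j 1) i) :
      fderiv ℝ (fun y => e (y, q.2)) q.1 (G q) = fderiv ℝ k q (G q, 0) (Pi.single j 1) i := by
    have h1 := (hcoord hk i j).congr_of_eventuallyEq
      (Filter.mem_of_superset (hO.mem_nhds hq) fun p hp => he p hp)
    rw [fderiv_comp_prodMk_left h1.differentiableAt, h1.fderiv]
    rfl
  have hhess : ∀ i j, ∀ q ∈ M ×ˢ Ω, hessXi (d + 1) φ q.1 q.2 i j = H q (Pi.single j 1) i :=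
    fun i j q hq => by
      have h1 := fderiv_comp_prodMk_right (k := fun q => F q i)
        (differentiableAt_pi.1 (hdiff (hFs q hq)) i) (Pi.single j 1)
      rw [fderiv_apply_coord (hdiff (hFs q hq))] at h1
      exact h1
  have hGD : ∀ i j, ∀ q ∈ M ×ˢ Ω, GDhess (d + 1) φ q.1 q.2 i j = GH q (Pi.single j 1) i :=
    fun i j q hq => hGDe (e := fun q => hessXi (d + 1) φ q.1 q.2 i j) hq (hdiff (hHs q hq)) i j
      (hhess i j)
  have hGD2 : ∀ i j, ∀ q ∈ M ×ˢ Ω, GD2hess (d + 1) φ q.1 q.2 i j =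
      fderiv ℝ GH q (G q, 0) (Pi.single j 1) i :=
    fun i j q hq => hGDe (e := fun q => GDhess (d + 1) φ q.1 q.2 i j) hq (hdiff (hGHs q hq)) i j
      (hGD i j)
  have hinj : ∀ q ∈ M ×ˢ Ω, Function.Injective (GH q) := fun q hq => by
    refine (injective_iff_map_eq_zero _).2 fun v hv => ?_
    refine Matrix.eq_zero_of_mulVec_eq_zero (hdet q.1 hq.1 q.2 hq.2) ?_
    ext i
    rw [Matrix.mulVec, dotProduct]
    simp only [hGD _ _ q hq]
    have h1 : GH q v = GH q (∑ j, v j • Pi.single j 1) := by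
      congr 1
      exact (Pi.basisFun ℝ (Fin d)).sum_repr v |>.symm.trans (by simp)
    rw [hv, map_sum] at h1
    simp only [map_smul] at h1
    have h2 := congrFun h1 i
    simp only [Finset.sum_apply, Pi.smul_apply, smul_eq_mul, Pi.zero_apply] at h2
    rw [Pi.zero_apply, h2]
    exact Finset.sum_congr rfl fun j _ => mul_comm _ _
  have hG0 : ∀ q ∈ M ×ˢ Ω, G q ≠ 0 := fun q hq h0 => by
    have h2 : GH q = 0 := by
      simp only [hGH]
      rw [h0]
      exact map_zero _
    have h1 := @hinj q hq (Pi.single ⟨0, hd⟩ 1) 0 (by simp [h2])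
    simpa using congrFun h1 ⟨0, hd⟩
  intro x hx ξ hξ
  have hq₁ : (x, ξ) ∈ M ×ˢ Ω := ⟨hx, hξ⟩
  refine _root_.exists_straightenedPatch hd (hFs _ hq₁) (hGs _ hq₁) hH hGH ?_ (hinj _ hq₁)
    ⟨fun q => lam q.1 q.2, ?_⟩
  · filter_upwards [hO.mem_nhds hq₁] with q hq v hv
    refine exists_eq_smul_gaussMap (hr q.1 hq.1 q.2 hq.2) (hG0 q hq) ?_
    ext j
    rw [Matrix.vecMul, dotProduct]
    simp only [hmix q hq]
    have h1 : (v, (0 : Fin d → ℝ)) = ∑ i, v i • (Pi.single i 1, 0) := by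
      have h2 := (Pi.basisFun ℝ (Fin (d + 1))).sum_repr v
      simp only [Pi.basisFun_repr, Pi.basisFun_apply] at h2
      refine Prod.ext ?_ ?_
      · simp [Prod.fst_sum, h2]
      · simp [Prod.snd_sum]
    rw [h1, map_sum] at hv
    simp only [map_smul] at hv
    simpa using congrFun hv j
  · filter_upwards [hO.mem_nhds hq₁] with q hq
    refine ContinuousLinearMap.coe_injective ((Pi.basisFun ℝ (Fin d)).ext fun j => ?_)
    ext i
    have h1 := congrFun (congrFun (hB q.1 hq.1 q.2 hq.2) i) j
    rw [hGD2 i j q hq, Matrix.smul_apply, hGD i j q hq] at h1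
    simpa using h1

end

section

lemma StraightenedPatch.measurableSet_dist_le {d : ℕ} {B : Set (Fin (d + 1) → ℝ)}
    {U : Set (Fin d → ℝ)} {F : (Fin (d + 1) → ℝ) → (Fin d → ℝ) → Fin d → ℝ}
    {h : (Fin (d + 1) → ℝ) → (Fin d → ℝ) → ℝ} {L : ℕ} (hp : StraightenedPatch B U F h L)
    {ξ : Fin d → ℝ} (hξ : ξ ∈ U) (v : Fin d → ℝ) (a : ℝ) :
    MeasurableSet {y ∈ B | dist (F y ξ) v ≤ a} := by
  have hc : ContinuousOn (fun y => F y ξ) B :=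
    (LipschitzOnWith.of_dist_le_mul (K := L) fun y hy y' hy' => by
      simpa using hp.lip y hy y' hy' ξ hξ ξ hξ).continuousOn
  obtain ⟨u, hu, hu'⟩ := continuousOn_iff_isClosed.1 hc _ (isClosed_closedBall (x := v) (ε := a))
  have h1 : {y ∈ B | dist (F y ξ) v ≤ a} = u ∩ B := by
    rw [← hu']
    ext y
    simp [and_comm]
  rw [h1]
  exact hu.measurableSet.inter hp.measurableSet

/-- Local estimates on patches around each point of a compact set combine to a global one. -/
lemma exists_SKp_of_patches {d : ℕ} (hS : StraightStickyKakeya d)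
    {φ : (Fin (d + 1) → ℝ) → (Fin d → ℝ) → ℝ} (M : Set (Fin (d + 1) → ℝ))
    {M₀ : Set (Fin (d + 1) → ℝ)} {S₀ : Set (Fin d → ℝ)} (hM₀ : IsCompact M₀) (hS₀ : IsCompact S₀)
    (hp : ∀ x ∈ M₀, ∀ ξ ∈ S₀, ∃ r > 0, ∃ h L,
      StraightenedPatch (ball x r) (ball ξ r) (gradXi (d + 1) φ) h L) {ε : ℝ} (hε : 0 < ε) :
    ∃ η : ℝ, 0 < η ∧ ∃ δ₀ : ℝ, 0 < δ₀ ∧ ∀ δ : ℝ, 0 < δ → δ < δ₀ →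
      SKp (d + 1) φ M M₀ S₀ ε η δ := by
  classical
  have hp' : ∀ q : (Fin (d + 1) → ℝ) × (Fin d → ℝ), ∃ r > 0, ∃ h L, q ∈ M₀ ×ˢ S₀ →
      StraightenedPatch (ball q.1 r) (ball q.2 r) (gradXi (d + 1) φ) h L := by
    intro q
    by_cases hq : q ∈ M₀ ×ˢ S₀
    · obtain ⟨r, hr, h, L, H⟩ := hp q.1 hq.1 q.2 hq.2
      exact ⟨r, hr, h, L, fun _ => H⟩
    · exact ⟨1, one_pos, 0, 0, fun h => absurd h hq⟩
  choose r hr h L hpatch using hp'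
  obtain ⟨T, hT, hcov⟩ := (hM₀.prod hS₀).elim_nhds_subcover (fun q => ball q (r q / 2))
    fun q _ => ball_mem_nhds _ (half_pos (hr q))
  have hK : ∀ q, ∃ η : ℝ, 0 < η ∧ (q ∈ T → ∀ᶠ δ : ℝ in 𝓝[>] 0,
      ∀ P : Finset ((Fin d → ℝ) × (Fin d → ℝ)),
      (∀ p ∈ P, p.1 ∈ ball q.2 (r q)) → SeparatedBy δ P → StickyCount P δ (δ ^ (-η)) →
      ∀ Y : ((Fin d → ℝ) × (Fin d → ℝ)) → Set (Fin (d + 1) → ℝ),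
      (∀ p ∈ P, MeasurableSet (Y p) ∧
        Y p ⊆ {y ∈ ball q.1 (r q) | dist (gradXi (d + 1) φ y p.1) p.2 ≤ (2 * L q + 2 : ℕ) * δ}) →
      ENNReal.ofReal (δ ^ η) ≤ ∑ p ∈ P, volume (Y p) →
      ENNReal.ofReal (δ ^ ε) ≤ volume (⋃ p ∈ P, Y p)) := by
    intro q
    by_cases hq : q ∈ T
    · obtain ⟨η, h1, h2⟩ := (hpatch q (hT q hq)).patchKakeya hS le_rfl hε
      exact ⟨η, h1, fun _ => h2⟩
    · exact ⟨1, one_pos, fun h => absurd h hq⟩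
  choose η' hη' hKak using hK
  obtain ⟨η, hη, hηT⟩ : ∃ η : ℝ, 0 < η ∧ ∀ q ∈ T, η < η' q := by
    have h1 : ∀ᶠ η : ℝ in 𝓝[>] 0, ∀ q ∈ T, η < η' q := (Filter.eventually_all_finset T).2
      fun q _ => mem_nhdsWithin_of_mem_nhds (Iio_mem_nhds (hη' q))
    obtain ⟨η, h2, h3⟩ := (h1.and self_mem_nhdsWithin).exists
    exact ⟨η, h3, h2⟩
  have hev : ∀ᶠ δ : ℝ in 𝓝[>] 0, SKp (d + 1) φ M M₀ S₀ ε η δ := by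
    filter_upwards [self_mem_nhdsWithin, (Filter.eventually_all_finset T).2
      fun q hq => (hKak q hq).and ((eventually_mul_rpow_le (T.card + 1) (hηT q hq)).and
        ((eventually_mul_rpow_le (9 ^ d * 9 ^ d * 7 ^ d) (neg_lt_neg (hηT q hq))).and
        (mem_nhdsWithin_of_mem_nhds (Iio_mem_nhds (half_pos (hr q))))))] with δ hδ hall
    have hδ : 0 < δ := hδ
    intro P hP hsep hst Y hY hsum
    by_contra! hlt
    set N : (Fin (d + 1) → ℝ) × (Fin d → ℝ) → (Fin d → ℝ) × (Fin d → ℝ) → Set (Fin (d + 1) → ℝ) :=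
      fun q p => {y ∈ ball q.1 (r q) | dist (gradXi (d + 1) φ y p.1) p.2 ≤ (2 * L q + 2 : ℕ) * δ}
    set Pq : (Fin (d + 1) → ℝ) × (Fin d → ℝ) → Finset ((Fin d → ℝ) × (Fin d → ℝ)) :=
      fun q => P.filter fun p => p.1 ∈ ball q.2 (r q)
    have hmeas : ∀ q ∈ T, ∀ p ∈ Pq q, MeasurableSet (N q p) := fun q hq p hp =>
      (hpatch q (hT q hq)).measurableSet_dist_le (Finset.mem_filter.1 hp).2 _ _
    have hsmall : ∀ q ∈ T, ∑ p ∈ Pq q, volume (Y p ∩ N q p) ≤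
        ENNReal.ofReal (δ ^ η / (T.card + 1)) := by
      intro q hq
      obtain ⟨h1, h2, h3, -⟩ := hall q hq
      have h4 : δ ^ η' q ≤ δ ^ η / (T.card + 1) := by
        rw [le_div_iff₀ (by positivity)]
        linarith
      refine le_trans ?_ (ENNReal.ofReal_le_ofReal h4)
      by_contra! h5
      refine hlt.not_ge ((h1 (Pq q) (fun p hp => (Finset.mem_filter.1 hp).2)
        (SeparatedBy.mono hsep (Finset.filter_subset _ _)) ?_ (fun p => Y p ∩ N q p)
        (fun p hp => ⟨(hY p (Finset.mem_filter.1 hp).1).1.inter (hmeas q hq p hp),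
          inter_subset_right⟩) h5.le).trans (measure_mono ?_))
      · refine (stickyCount_of_cover (N := δ ^ (-η)) hδ fun ρ hρ => ?_).mono
          (Finset.filter_subset _ _) le_rfl (by linarith)
        obtain ⟨Q, -, h6, h7⟩ := hst ρ hρ
        exact ⟨Q, h6, h7⟩
      · exact iUnion₂_subset fun p hp => inter_subset_left.trans
          (subset_biUnion_of_mem (u := Y) (Finset.mem_filter.1 hp).1)
    have hcovY : ∀ p ∈ P, Y p ⊆ ⋃ q ∈ T.filter (fun q => p.1 ∈ ball q.2 (r q)), Y p ∩ N q p := by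
      intro p hp y hy
      obtain ⟨x, ⟨⟨-, hx⟩, hxM⟩, hyx⟩ := (hY p hp).2 hy
      obtain ⟨q, hq, hxq⟩ := mem_iUnion₂.1 (hcov (show (x, p.1) ∈ M₀ ×ˢ S₀ from ⟨hxM, (hP p hp).1⟩))
      rw [mem_ball, Prod.dist_eq, max_lt_iff] at hxq
      obtain ⟨-, -, -, h1⟩ := hall q hq
      have h1 : δ < r q / 2 := h1
      have h2 : p.1 ∈ ball q.2 (r q) := hxq.2.trans (half_lt_self (hr q))
      have h3 : x ∈ ball q.1 (r q) := hxq.1.trans (half_lt_self (hr q))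
      have h4 : y ∈ ball q.1 (r q) := by
        have h5 : dist x q.1 < r q / 2 := hxq.1
        rw [mem_ball]
        linarith [dist_triangle y x q.1]
      refine mem_iUnion₂.2 ⟨q, Finset.mem_filter.2 ⟨hq, h2⟩, hy, h4, ?_⟩
      have h5 := (hpatch q (hT q hq)).lip y h4 x h3 p.1 h2 p.1 h2
      rw [hx, dist_self, add_zero] at h5
      refine h5.trans ?_
      push_cast
      nlinarith [(L q).cast_nonneg (α := ℝ), mul_le_mul_of_nonneg_left hyx (L q).cast_nonneg]
    have htot : ∑ p ∈ P, volume (Y p) ≤ T.card * ENNReal.ofReal (δ ^ η / (T.card + 1)) := by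
      calc ∑ p ∈ P, volume (Y p)
          ≤ ∑ p ∈ P, ∑ q ∈ T.filter (fun q => p.1 ∈ ball q.2 (r q)), volume (Y p ∩ N q p) :=
            Finset.sum_le_sum fun p hp =>
              (measure_mono (hcovY p hp)).trans (measure_biUnion_finset_le _ _)
        _ = ∑ q ∈ T, ∑ p ∈ Pq q, volume (Y p ∩ N q p) := by
            refine Finset.sum_comm' fun p q => ?_
            simp only [Pq, Finset.mem_filter]
            tauto
        _ ≤ ∑ q ∈ T, ENNReal.ofReal (δ ^ η / (T.card + 1)) := Finset.sum_le_sum hsmall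
        _ = _ := by rw [Finset.sum_const, nsmul_eq_mul]
    have hδη : 0 < δ ^ η := Real.rpow_pos_of_pos hδ _
    refine (hsum.trans htot).not_gt ?_
    rw [← ENNReal.ofReal_natCast, ← ENNReal.ofReal_mul (Nat.cast_nonneg _)]
    refine (ENNReal.ofReal_lt_ofReal_iff hδη).2 ?_
    rw [mul_div_assoc', div_lt_iff₀ (by positivity)]
    linarith
  obtain ⟨δ₀, h1, h2⟩ := mem_nhdsGT_iff_exists_Ioo_subset.1 hev
  exact ⟨η, hη, δ₀, h1, fun δ h3 h4 => h2 ⟨h3, h4⟩⟩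

end

theorem stmt18 (m : ℕ)
    (M : Set (Fin (m+3) → ℝ)) (Ω : Set (Fin (m+2) → ℝ))
    (hMo : IsOpen M) (hMc : IsConnected M) (hΩo : IsOpen Ω) (hΩc : IsConnected Ω)
    (φ : (Fin (m+3) → ℝ) → (Fin (m+2) → ℝ) → ℝ)
    (hφ : IsHormander (m+3) φ M Ω)
    (hB : BourgainCond (m+3) φ M Ω)
    (x₀ : Fin (m+3) → ℝ) (r₀ : ℝ) (hr₀ : 0 < r₀) (hM₀ : closedBall x₀ r₀ ⊆ M)
    (ξc : Fin (m+2) → ℝ) (r₁ : ℝ) (hr₁ : 0 < r₁) (hS₀ : closedBall ξc r₁ ⊆ Ω)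
    (hrest : ∀ ε : ℝ, 0 < ε → ∃ η : ℝ, 0 < η ∧ ∃ δ₀ : ℝ, 0 < δ₀ ∧
      ∀ δ : ℝ, 0 < δ → δ < δ₀ →
        SKp (m+3) (φrest (m+2)) univ (closedBall 0 1) (closedBall 0 1) ε η δ) :
    ∀ ε : ℝ, 0 < ε → ∃ η : ℝ, 0 < η ∧ ∃ δ₀ : ℝ, 0 < δ₀ ∧
      ∀ δ : ℝ, 0 < δ → δ < δ₀ →
        SKp (m+3) φ M (closedBall x₀ r₀) (closedBall ξc r₁) ε η δ := by
  intro ε hε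
  exact exists_SKp_of_patches (straightStickyKakeya_of_SKp hrest) M (isCompact_closedBall _ _)
    (isCompact_closedBall _ _) (fun x hx ξ hξ => hφ.exists_straightenedPatch (by omega) hMo hΩo hB
      x (hM₀ hx) ξ (hS₀ hξ)) hε
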